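/- arXiv:1910.08204 — 5 statements merged into one kernel-verified Lean document; each statement's English description precedes it below -/
import Mathlib

section
/- A continuously differentiable unipotent map G : ℝ² → ℝ² has no periodic points: for every z ∈ ℝ² and every integer n ≥ 1, if G^n(z) = z then G(z) = z. -/
open Filter Topology

/-- A differentiable planar map is *unipotent* if at every point the Jacobian has
both eigenvalues equal to `1`; equivalently the trace of the Jacobian is `2` and
its determinant is `1` everywhere. -/
def Unipotent (G : ℝ × ℝ → ℝ × ℝ) : Prop :=
  ∀ z : ℝ × ℝ,
    (fderiv ℝ G z (1, 0)).1 + (fderiv ℝ G z (0, 1)).2 = 2 ∧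
    (fderiv ℝ G z (1, 0)).1 * (fderiv ℝ G z (0, 1)).2 -
      (fderiv ℝ G z (0, 1)).1 * (fderiv ℝ G z (1, 0)).2 = 1

/-- A planar map is *nonlinear* if its derivative is not constant, i.e. it is not affine. -/
def NonlinearMap (G : ℝ × ℝ → ℝ × ℝ) : Prop :=
  ¬ ∃ A : (ℝ × ℝ) →L[ℝ] ℝ × ℝ, ∀ z : ℝ × ℝ, fderiv ℝ G z = A

/-- A real function is *nonlinear* if it is not of the form `t ↦ k * t`. -/
def NonlinearFun (ψ : ℝ → ℝ) : Prop :=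
  ¬ ∃ k : ℝ, ∀ t : ℝ, ψ t = k * t

/-- The linear rotation by angle `θ`. -/
noncomputable def Rot (θ : ℝ) (p : ℝ × ℝ) : ℝ × ℝ :=
  (p.1 * Real.cos θ - p.2 * Real.sin θ, p.1 * Real.sin θ + p.2 * Real.cos θ)

/-- The map `(P, Q)` of the plane has the continuous Jacobian `[[α, β], [γ, -α]]`,
and this matrix is nilpotent at every point. -/
structure HasNilpotentJacobian (P Q α β γ : ℝ × ℝ → ℝ) : Prop where
  hasFDerivAt_left (z) : HasFDerivAt P
    (α z • ContinuousLinearMap.fst ℝ ℝ ℝ + β z • ContinuousLinearMap.snd ℝ ℝ ℝ) z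
  hasFDerivAt_right (z) : HasFDerivAt Q
    (γ z • ContinuousLinearMap.fst ℝ ℝ ℝ + (-α z) • ContinuousLinearMap.snd ℝ ℝ ℝ) z
  continuous_diag : Continuous α
  continuous_upper : Continuous β
  continuous_lower : Continuous γ
  det_eq_zero (z) : α z ^ 2 + β z * γ z = 0

/-- The linear automorphism `(x, y) ↦ (x, a * x + b * y)` of the plane. -/
noncomputable def lowerTriangularEquiv (a b : ℝ) (hb : b ≠ 0) : (ℝ × ℝ) ≃L[ℝ] ℝ × ℝ :=
  ContinuousLinearEquiv.equivOfInverse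
    ((ContinuousLinearMap.fst ℝ ℝ ℝ).prod
      (a • ContinuousLinearMap.fst ℝ ℝ ℝ + b • ContinuousLinearMap.snd ℝ ℝ ℝ))
    ((ContinuousLinearMap.fst ℝ ℝ ℝ).prod
      ((-a / b) • ContinuousLinearMap.fst ℝ ℝ ℝ + b⁻¹ • ContinuousLinearMap.snd ℝ ℝ ℝ))
    (fun z => by ext <;> simp; field_simp; ring)
    (fun z => by ext <;> simp; field_simp; ring)

namespace HasNilpotentJacobian

variable {P Q α β γ : ℝ × ℝ → ℝ}

theorem swap (h : HasNilpotentJacobian P Q α β γ) :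
    HasNilpotentJacobian (Q ∘ Prod.swap) (P ∘ Prod.swap) (-α ∘ Prod.swap) (γ ∘ Prod.swap)
      (β ∘ Prod.swap) where
  hasFDerivAt_left z := by
    refine ((h.hasFDerivAt_right z.swap).comp z
      (ContinuousLinearEquiv.prodComm ℝ ℝ ℝ).hasFDerivAt).congr_fderiv ?_
    ext <;> simp
  hasFDerivAt_right z := by
    refine ((h.hasFDerivAt_left z.swap).comp z
      (ContinuousLinearEquiv.prodComm ℝ ℝ ℝ).hasFDerivAt).congr_fderiv ?_
    ext <;> simp
  continuous_diag := (h.continuous_diag.comp continuous_swap).neg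
  continuous_upper := h.continuous_lower.comp continuous_swap
  continuous_lower := h.continuous_upper.comp continuous_swap
  det_eq_zero z := by
    have := h.det_eq_zero z.swap
    simp only [Function.comp_apply, Pi.neg_apply]
    linarith

/-- Near a point with `β ≠ 0`, the map `(x, y) ↦ (x, P (x, y))` has a local inverse
`(x, u) ↦ (x, Y x u)` defined on a square. -/
theorem exists_local_inverse (h : HasNilpotentJacobian P Q α β γ) {q : ℝ × ℝ} (hq : β q ≠ 0) :
    ∃ ε > 0, ∃ Y : ℝ → ℝ → ℝ, Y q.1 (P q) = q.2 ∧
      ∀ x ∈ Metric.ball q.1 ε, ∀ u ∈ Metric.ball (P q) ε,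
        β (x, Y x u) ≠ 0 ∧
        HasDerivAt (fun s => Y s u) (-α (x, Y x u) / β (x, Y x u)) x ∧
        HasDerivAt (Y x) (β (x, Y x u))⁻¹ u := by
  set Φ : ℝ × ℝ → ℝ × ℝ := fun z => (z.1, P z)
  have hder (z : ℝ × ℝ) (hz : β z ≠ 0) :
      HasFDerivAt Φ (lowerTriangularEquiv (α z) (β z) hz : (ℝ × ℝ) →L[ℝ] ℝ × ℝ) z :=
    hasFDerivAt_fst.prodMk (h.hasFDerivAt_left z)
  have hstrict : HasStrictFDerivAt Φ
      (lowerTriangularEquiv (α q) (β q) hq : (ℝ × ℝ) →L[ℝ] ℝ × ℝ) q := by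
    refine hasStrictFDerivAt_of_hasFDerivAt_of_continuousAt
      (f' := fun z => (ContinuousLinearMap.fst ℝ ℝ ℝ).prod
        (α z • ContinuousLinearMap.fst ℝ ℝ ℝ + β z • ContinuousLinearMap.snd ℝ ℝ ℝ))
      (Eventually.of_forall fun z => hasFDerivAt_fst.prodMk (h.hasFDerivAt_left z)) ?_
    have h1 := h.continuous_diag
    have h2 := h.continuous_upper
    have : Continuous fun z => (ContinuousLinearMap.fst ℝ ℝ ℝ).prod
        (α z • ContinuousLinearMap.fst ℝ ℝ ℝ + β z • ContinuousLinearMap.snd ℝ ℝ ℝ) := by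
      have h3 : Continuous fun z =>
          α z • ContinuousLinearMap.fst ℝ ℝ ℝ + β z • ContinuousLinearMap.snd ℝ ℝ ℝ := by
        fun_prop
      exact (ContinuousLinearMap.prodₗᵢ ℝ).continuous.comp
        ((continuous_const (y := ContinuousLinearMap.fst ℝ ℝ ℝ)).prodMk h3)
    exact this.continuousAt
  set e := hstrict.toOpenPartialHomeomorph Φ
  have hqs : q ∈ e.source := hstrict.mem_toOpenPartialHomeomorph_source
  have hopen : IsOpen (e.target ∩ e.symm ⁻¹' {z | β z ≠ 0}) :=
    e.symm.isOpen_inter_preimage (isOpen_ne_fun h.continuous_upper continuous_const)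
  have hmem : Φ q ∈ e.target ∩ e.symm ⁻¹' {z | β z ≠ 0} := by
    refine ⟨e.map_source hqs, ?_⟩
    have : e.symm (Φ q) = q := e.left_inv hqs
    simpa [this] using hq
  obtain ⟨ε, hε, hball⟩ := Metric.isOpen_iff.1 hopen _ hmem
  refine ⟨ε, hε, fun x u => (e.symm (x, u)).2, ?_, fun x hx u hu => ?_⟩
  · exact congrArg Prod.snd (e.left_inv hqs)
  · have hxu : (x, u) ∈ e.target ∩ e.symm ⁻¹' {z | β z ≠ 0} := by
      refine hball ?_
      rw [← ball_prod_same]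
      exact ⟨hx, hu⟩
    obtain ⟨ht, hβ⟩ := hxu
    have hfst : (x, (e.symm (x, u)).2) = e.symm (x, u) := by
      have : (e.symm (x, u)).1 = x := congrArg Prod.fst (e.right_inv ht)
      ext <;> simp [this]
    rw [hfst]
    have hsymm := e.hasFDerivAt_symm ht (hder _ hβ)
    refine ⟨hβ, ?_, ?_⟩
    · refine (hsymm.snd.comp_hasDerivAt x
        ((hasDerivAt_id x).prodMk (hasDerivAt_const x u))).congr_deriv ?_
      simp [lowerTriangularEquiv]
    · refine (hsymm.snd.comp_hasDerivAt u
        ((hasDerivAt_const u x).prodMk (hasDerivAt_id u))).congr_deriv ?_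
      simp [lowerTriangularEquiv]

/-- Near a point with `β ≠ 0`, the kernel direction of the Jacobian is constant along the line it
spans, and `β⁻¹` is affine along that line. -/
theorem exists_local_ruling (h : HasNilpotentJacobian P Q α β γ) {q : ℝ × ℝ} (hq : β q ≠ 0)
    {m : ℝ} (hm : α q = -m * β q) :
    ∃ κ : ℝ, ∀ᶠ t in 𝓝 (0 : ℝ), β (q.1 + t, q.2 + t * m) ≠ 0 ∧
      α (q.1 + t, q.2 + t * m) = -m * β (q.1 + t, q.2 + t * m) ∧
      (β (q.1 + t, q.2 + t * m))⁻¹ = (β q)⁻¹ + κ * t := by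
  obtain ⟨ε, hε, Y, hYq, hY⟩ := h.exists_local_inverse hq
  obtain ⟨x₀, y₀⟩ := q
  simp only at hYq hY ⊢
  set u₀ := P (x₀, y₀)
  have hx₀ : x₀ ∈ Metric.ball x₀ ε := Metric.mem_ball_self hε
  have hu₀ : u₀ ∈ Metric.ball u₀ ε := Metric.mem_ball_self hε
  -- `Q` is constant along the level curves of `P`
  have hQx : ∀ u ∈ Metric.ball u₀ ε, ∀ x ∈ Metric.ball x₀ ε, Q (x, Y x u) = Q (x₀, Y x₀ u) := by
    intro u hu x hx
    have key : ∀ x ∈ Metric.ball x₀ ε, HasDerivAt (fun s => Q (s, Y s u)) 0 x := by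
      intro x hx
      obtain ⟨hβ, hYx, -⟩ := hY x hx u hu
      refine ((h.hasFDerivAt_right (x, Y x u)).comp_hasDerivAt x
        ((hasDerivAt_id x).prodMk hYx)).congr_deriv ?_
      have := h.det_eq_zero (x, Y x u)
      simp
      field_simp
      linarith
    exact Metric.isOpen_ball.is_const_of_deriv_eq_zero (convex_ball x₀ ε).isPreconnected
      (fun s hs => (key s hs).differentiableAt.differentiableWithinAt)
      (fun s hs => (key s hs).deriv) hx hx₀
  have hslope : ∀ u ∈ Metric.ball u₀ ε, ∀ x ∈ Metric.ball x₀ ε,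
      -α (x, Y x u) / β (x, Y x u) = -α (x₀, Y x₀ u) / β (x₀, Y x₀ u) := by
    intro u hu x hx
    have key : ∀ x ∈ Metric.ball x₀ ε,
        HasDerivAt (fun s => Q (x, Y x s)) (-α (x, Y x u) / β (x, Y x u)) u := by
      intro x hx
      obtain ⟨hβ, -, hYu⟩ := hY x hx u hu
      refine ((h.hasFDerivAt_right (x, Y x u)).comp_hasDerivAt u
        ((hasDerivAt_const u x).prodMk hYu)).congr_deriv ?_
      simp
      ring
    refine ((key x hx).congr_of_eventuallyEq ?_).unique (key x₀ hx₀)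
    filter_upwards [Metric.isOpen_ball.mem_nhds hu] with s hs using (hQx s hs x hx).symm
  have hline : ∀ u ∈ Metric.ball u₀ ε, ∀ x ∈ Metric.ball x₀ ε,
      Y x u = Y x₀ u + (x - x₀) * (-α (x₀, Y x₀ u) / β (x₀, Y x₀ u)) := by
    intro u hu x hx
    have key : ∀ x ∈ Metric.ball x₀ ε, HasDerivAt
        (fun s => Y s u - (s - x₀) * (-α (x₀, Y x₀ u) / β (x₀, Y x₀ u))) 0 x := by
      intro x hx
      refine ((hY x hx u hu).2.1.sub (((hasDerivAt_id x).sub_const x₀).mul_const _)).congr_deriv ?_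
      rw [hslope u hu x hx]
      ring
    have := Metric.isOpen_ball.is_const_of_deriv_eq_zero (convex_ball x₀ ε).isPreconnected
      (fun s hs => (key s hs).differentiableAt.differentiableWithinAt)
      (fun s hs => (key s hs).deriv) hx hx₀
    simp only [sub_self, zero_mul, sub_zero] at this
    linarith
  have hx₁ : x₀ + ε / 2 ∈ Metric.ball x₀ ε := by
    simp [abs_of_pos hε, hε]
  have hmu : -α (x₀, y₀) / β (x₀, y₀) = m := by
    rw [hm]; field_simp
  refine ⟨((β (x₀ + ε / 2, Y (x₀ + ε / 2) u₀))⁻¹ - (β (x₀, y₀))⁻¹) / (ε / 2), ?_⟩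
  filter_upwards [Metric.ball_mem_nhds (0 : ℝ) hε] with t ht
  have hx : x₀ + t ∈ Metric.ball x₀ ε := by simpa using ht
  have hYt : Y (x₀ + t) u₀ = y₀ + t * m := by
    rw [hline u₀ hu₀ _ hx, hYq, hmu]
    ring
  rw [← hYt]
  obtain ⟨hβ, -, hYu⟩ := hY _ hx u₀ hu₀
  refine ⟨hβ, ?_, ?_⟩
  · have := hslope u₀ hu₀ _ hx
    rw [hYq, hmu, div_eq_iff hβ] at this
    linarith
  · have h₀ := (hY _ hx₀ u₀ hu₀).2.2
    have h₁ := (hY _ hx₁ u₀ hu₀).2.2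
    have hcomb := h₀.add ((h₁.sub h₀).const_mul (t / (ε / 2)))
    have := hYu.unique (hcomb.congr_of_eventuallyEq ?_)
    · rw [this, hYq]
      ring
    · filter_upwards [Metric.isOpen_ball.mem_nhds hu₀] with u hu
      rw [hline u hu _ hx]
      simp only [Pi.add_apply, Pi.sub_apply]
      rw [hline u hu _ hx₁]
      field_simp
      ring

/-- If `β ≠ 0` at a point, then `β ≠ 0` on the whole line spanned by the kernel of the Jacobian,
and the kernel is the same all along that line. -/
theorem ruling (h : HasNilpotentJacobian P Q α β γ) {p : ℝ × ℝ} (hp : β p ≠ 0)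
    {m : ℝ} (hm : α p = -m * β p) (t : ℝ) :
    β (p.1 + t, p.2 + t * m) ≠ 0 ∧
      α (p.1 + t, p.2 + t * m) = -m * β (p.1 + t, p.2 + t * m) := by
  set L : ℝ → ℝ × ℝ := fun t => (p.1 + t, p.2 + t * m) with hL
  have hLc : Continuous L := by fun_prop
  have hgc : Continuous (β ∘ L) := h.continuous_upper.comp hLc
  set S : Set ℝ := {t | β (L t) ≠ 0 ∧ α (L t) = -m * β (L t)} with hS
  have hloc : ∀ t ∈ S, ∃ κ : ℝ, ∀ᶠ s in 𝓝 t,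
      s ∈ S ∧ (β (L s))⁻¹ = (β (L t))⁻¹ + κ * (s - t) := by
    rintro t ⟨ht, ht'⟩
    obtain ⟨κ, hκ⟩ := h.exists_local_ruling ht ht'
    refine ⟨κ, ?_⟩
    have htend : Tendsto (fun s => s - t) (𝓝 t) (𝓝 0) := by
      simpa using (continuous_id.sub continuous_const).tendsto (x := t) (f := fun s => s - t)
    filter_upwards [htend.eventually hκ] with s hs
    have : ((L t).1 + (s - t), (L t).2 + (s - t) * m) = L s := by
      simp only [hL, Prod.mk.injEq]
      constructor <;> ring
    rw [this] at hs
    exact ⟨⟨hs.1, hs.2.1⟩, hs.2.2⟩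
  have hSo : IsOpen S := isOpen_iff_mem_nhds.2 fun t ht => by
    obtain ⟨κ, hκ⟩ := hloc t ht
    exact hκ.mono fun s hs => hs.1
  have h0 : (0 : ℝ) ∈ S := by simpa [hS, hL] using And.intro hp (by simpa using hm)
  set C := connectedComponentIn S 0
  have hCS : C ⊆ S := connectedComponentIn_subset S 0
  have hCo : IsOpen C := hSo.connectedComponentIn
  have hCp : IsPreconnected C := isPreconnected_connectedComponentIn
  have hC0 : (0 : ℝ) ∈ C := mem_connectedComponentIn h0
  set f : ℝ → ℝ := fun s => (β (L s))⁻¹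
  have hderiv : ∀ t ∈ S, ∃ κ : ℝ, ∀ᶠ s in 𝓝 t, HasDerivAt f κ s := by
    intro t ht
    obtain ⟨κ, hκ⟩ := hloc t ht
    refine ⟨κ, ?_⟩
    filter_upwards [hκ.eventually_nhds] with s hs
    have : HasDerivAt (fun s => (β (L t))⁻¹ + κ * (s - t)) κ s := by
      simpa using (((hasDerivAt_id s).sub_const t).const_mul κ).const_add (β (L t))⁻¹
    exact this.congr_of_eventuallyEq (hs.mono fun r hr => hr.2)
  have hderiv2 : ∀ t ∈ S, HasDerivAt (deriv f) 0 t := by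
    intro t ht
    obtain ⟨κ, hκ⟩ := hderiv t ht
    exact (hasDerivAt_const t κ).congr_of_eventuallyEq (hκ.mono fun s hs => hs.deriv)
  set k := deriv f 0
  have hkc : ∀ t ∈ C, deriv f t = k := fun t ht =>
    hCo.is_const_of_deriv_eq_zero hCp
      (fun s hs => (hderiv2 s (hCS hs)).differentiableAt.differentiableWithinAt)
      (fun s hs => (hderiv2 s (hCS hs)).deriv) ht hC0
  have hkd : ∀ t ∈ C, HasDerivAt (fun s => f s - k * s) 0 t := by
    intro t ht
    obtain ⟨κ, hκ⟩ := hderiv t (hCS ht)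
    have hd : HasDerivAt f k t := by
      rw [← hkc t ht]
      exact hκ.self_of_nhds.differentiableAt.hasDerivAt
    exact (hd.sub ((hasDerivAt_id t).const_mul k)).congr_deriv (by simp)
  have haff : ∀ t ∈ C, f t = f 0 + k * t := fun t ht => by
    have := hCo.is_const_of_deriv_eq_zero hCp
      (fun s hs => (hkd s hs).differentiableAt.differentiableWithinAt)
      (fun s hs => (hkd s hs).deriv) ht hC0
    simp only [mul_zero, sub_zero] at this
    linarith
  have hclS : closure C ⊆ S := by
    intro t ht
    have h1 : β (L t) * (f 0 + k * t) = 1 := by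
      have hcl : IsClosed {t | β (L t) * (f 0 + k * t) = 1} :=
        isClosed_eq (hgc.mul (by fun_prop)) continuous_const
      refine closure_minimal (fun s hs => ?_) hcl ht
      simp only [Set.mem_ofPred_eq]
      rw [← haff s hs]
      exact mul_inv_cancel₀ (hCS hs).1
    have h2 : α (L t) = -m * β (L t) := by
      have hcl : IsClosed {t | α (L t) = -m * β (L t)} :=
        isClosed_eq (h.continuous_diag.comp hLc) (continuous_const.mul hgc)
      exact closure_minimal (fun s hs => (hCS hs).2) hcl ht
    exact ⟨left_ne_zero_of_mul_eq_one h1, h2⟩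
  have hCc : IsClosed C := by
    refine isClosed_of_closure_subset ?_
    exact hCp.closure.subset_connectedComponentIn (subset_closure hC0) hclS
  have huniv : C = Set.univ := IsClopen.eq_univ ⟨hCc, hCo⟩ ⟨0, hC0⟩
  exact hCS (huniv ▸ Set.mem_univ t)

/-- A planar map with nilpotent Jacobian has a common nonzero kernel vector for its Jacobians. -/
theorem exists_common_kernel (h : HasNilpotentJacobian P Q α β γ) :
    ∃ a b : ℝ, (a, b) ≠ (0, 0) ∧ ∀ z, α z * a + β z * b = 0 ∧ γ z * a - α z * b = 0 := by
  by_cases hβ : ∃ p, β p ≠ 0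
  · obtain ⟨p, hp⟩ := hβ
    set m := -α p / β p with hmdef
    have hm : α p = -m * β p := by rw [hmdef]; field_simp
    refine ⟨1, m, by simp, fun z => ?_⟩
    have hdet := h.det_eq_zero z
    by_cases hz : β z = 0
    · have hα : α z = 0 := by simpa [hz] using hdet
      have hγ : γ z = 0 := by
        by_contra hγ
        have hv := h.swap.ruling (p := z.swap) (m := 0) (by simpa using hγ)
          (by simp [hα]) (p.2 + (z.1 - p.1) * m - z.2)
        have hr := (h.ruling hp hm (z.1 - p.1)).1
        have hdet' := h.det_eq_zero (z.1, p.2 + (z.1 - p.1) * m)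
        simp only [Function.comp_apply, Pi.neg_apply, Prod.swap_prod_mk, Prod.fst_swap,
          Prod.snd_swap, mul_zero, add_zero, neg_zero, zero_mul, neg_eq_zero,
          add_sub_cancel] at hv hr
        rw [hv.2] at hdet'
        simp [hr, hv.1] at hdet'
      simp [hz, hα, hγ]
    · have hmz : α z = -m * β z := by
        by_contra hne
        set m' := -α z / β z with hmdef'
        have hm' : α z = -m' * β z := by rw [hmdef']; field_simp
        have hmm : m - m' ≠ 0 := by
          intro h0
          apply hne
          rw [hm', sub_eq_zero.1 h0]
        set t := (z.2 - p.2 - (z.1 - p.1) * m') / (m - m') with ht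
        have hr := h.ruling hp hm t
        have hr' := (h.ruling hz hm' (p.1 + t - z.1)).2
        have hpt : (z.1 + (p.1 + t - z.1), z.2 + (p.1 + t - z.1) * m') =
            (p.1 + t, p.2 + t * m) := by
          have : t * (m - m') = z.2 - p.2 - (z.1 - p.1) * m' := by rw [ht]; field_simp
          rw [Prod.mk.injEq]
          constructor <;> linarith
        rw [hpt, hr.2] at hr'
        have := mul_right_cancel₀ hr.1 hr'
        exact hmm (by linarith)
      refine ⟨by rw [hmz]; ring, ?_⟩
      apply mul_left_cancel₀ hz
      rw [hmz] at hdet ⊢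
      linarith
  · push Not at hβ
    refine ⟨0, 1, by simp, fun z => ?_⟩
    have hdet := h.det_eq_zero z
    simpa [hβ z] using hdet

end HasNilpotentJacobian

/-- The displacement `G - id` of a `C¹` unipotent planar map has nilpotent Jacobian. -/
theorem Unipotent.hasNilpotentJacobian {G : ℝ × ℝ → ℝ × ℝ} (hU : Unipotent G)
    (hG : ContDiff ℝ 1 G) :
    HasNilpotentJacobian (fun z => (G z).1 - z.1) (fun z => (G z).2 - z.2)
      (fun z => (fderiv ℝ G z (1, 0)).1 - 1) (fun z => (fderiv ℝ G z (0, 1)).1)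
      (fun z => (fderiv ℝ G z (1, 0)).2) := by
  have hd (z) : HasFDerivAt G (fderiv ℝ G z) z :=
    (hG.differentiable one_ne_zero z).hasFDerivAt
  have hc : Continuous (fderiv ℝ G) := hG.continuous_fderiv one_ne_zero
  have htr (z) : (fderiv ℝ G z (0, 1)).2 = 2 - (fderiv ℝ G z (1, 0)).1 := by
    linarith [(hU z).1]
  refine ⟨fun z => ?_, fun z => ?_, by fun_prop, by fun_prop, by fun_prop, fun z => ?_⟩
  · refine ((hd z).fst.sub hasFDerivAt_fst).congr_fderiv ?_
    ext <;> simp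
  · refine ((hd z).snd.sub hasFDerivAt_snd).congr_fderiv ?_
    ext <;> simp [htr]
    ring
  · have := (hU z).2
    rw [htr] at this
    linear_combination -this

/-- a `C¹` unipotent planar map has no periodic points. -/
theorem statement9 (G : ℝ × ℝ → ℝ × ℝ) (hG : ContDiff ℝ 1 G) (hU : Unipotent G) :
    ∀ z : ℝ × ℝ, ∀ n : ℕ, 1 ≤ n → G^[n] z = z → G z = z := by
  intro z n hn hz
  have h := hU.hasNilpotentJacobian hG
  obtain ⟨a, b, hab, hker⟩ := h.exists_common_kernel
  have hn0 : (n : ℝ) ≠ 0 := by positivity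
  -- the displacement is constant along the lines of direction `(a, b)`
  have hline (w : ℝ × ℝ) (t : ℝ) : G (w + t • (a, b)) = G w + t • (a, b) := by
    have hl (s : ℝ) : HasDerivAt (fun s : ℝ => w + s • (a, b)) (a, b) s := by
      simpa using ((hasDerivAt_id s).smul_const (a, b)).const_add w
    have h1 (s : ℝ) := ((h.hasFDerivAt_left (w + s • (a, b))).comp_hasDerivAt s (hl s)).congr_deriv
      (g' := 0) (by simpa using (hker (w + s • (a, b))).1)
    have h2 (s : ℝ) := ((h.hasFDerivAt_right (w + s • (a, b))).comp_hasDerivAt s (hl s)).congr_deriv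
      (g' := 0) (by
        have := (hker (w + s • (a, b))).2
        simp at this ⊢
        linarith)
    have e1 := is_const_of_deriv_eq_zero (fun s => (h1 s).differentiableAt)
      (fun s => (h1 s).deriv) t 0
    have e2 := is_const_of_deriv_eq_zero (fun s => (h2 s).differentiableAt)
      (fun s => (h2 s).deriv) t 0
    simp only [Function.comp_apply, zero_smul, add_zero, Prod.fst_add, Prod.snd_add] at e1 e2
    ext
    · rw [Prod.fst_add]
      linarith
    · rw [Prod.snd_add]
      linarith
  -- the displacement has a constant component transverse to `(a, b)`
  obtain ⟨k, hk⟩ : ∃ k : ℝ, ∀ w, b * ((G w).1 - w.1) - a * ((G w).2 - w.2) = k := by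
    have hd (w : ℝ × ℝ) := (((h.hasFDerivAt_left w).const_mul b).sub
      ((h.hasFDerivAt_right w).const_mul a)).congr_fderiv (g' := 0) (by
        obtain ⟨h1, h2⟩ := hker w
        ext
        · simp; linarith
        · simp; linarith)
    exact ⟨_, fun w => is_const_of_fderiv_eq_zero (fun s => (hd s).differentiableAt)
      (fun s => (hd s).fderiv) w 0⟩
  have hiter (j : ℕ) : b * (G^[j] z).1 - a * (G^[j] z).2 = b * z.1 - a * z.2 + j * k := by
    induction j with
    | zero => simp
    | succ j ih =>
      rw [Function.iterate_succ_apply']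
      push_cast
      linarith [hk (G^[j] z)]
  have hk0 : k = 0 := by
    have := hiter n
    rw [hz] at this
    simpa [hn0] using this
  obtain ⟨c, hc⟩ : ∃ c : ℝ, G z = z + c • (a, b) := by
    have hkz := hk z
    rw [hk0] at hkz
    by_cases ha : a = 0
    · have hb : b ≠ 0 := by rintro rfl; exact hab (by simp [ha])
      have h1 : (G z).1 - z.1 = 0 := by simpa [ha, hb] using hkz
      refine ⟨((G z).2 - z.2) / b, ?_⟩
      ext
      · simp [ha]; linarith
      · simp; field_simp; ring
    · refine ⟨((G z).1 - z.1) / a, ?_⟩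
      ext
      · simp; field_simp; ring
      · simp; field_simp; linarith
  have htrans (j : ℕ) : G^[j] z = z + (j * c) • (a, b) := by
    induction j with
    | zero => simp
    | succ j ih =>
      rw [Function.iterate_succ_apply', ih, hline, hc, add_assoc, ← add_smul]
      push_cast
      ring_nf
  have := htrans n
  rw [hz, left_eq_add, smul_eq_zero] at this
  have hc0 : c = 0 := by
    rcases this with h0 | h0
    · simpa [hn0] using h0
    · exact absurd h0 hab
  rw [hc, hc0, zero_smul, add_zero]
end

section
/- A continuously differentiable unipotent map G : ℝ² → ℝ² has no isolated fixed points: if G(z) = z, then for every ε > 0 there exists w ∈ ℝ² with w ≠ z, ‖w − z‖ < ε, and G(w) = w. -/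
open Filter Topology

open MeasureTheory

/-- The determinant of a linear endomorphism of the plane in terms of its matrix entries. -/
theorem det_prod_real (A : ℝ × ℝ →L[ℝ] ℝ × ℝ) :
    A.det = (A (1, 0)).1 * (A (0, 1)).2 - (A (0, 1)).1 * (A (1, 0)).2 := by
  rw [ContinuousLinearMap.det, ← LinearMap.det_toMatrix (Module.Basis.finTwoProd ℝ),
    Matrix.det_fin_two]
  simp [LinearMap.toMatrix_apply]

/-- A continuous open map which sends the centre of a ball to `0`, and whose norm is at least `ρ`
on the bounding sphere, covers the ball of radius `ρ` around `0`. -/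
theorem IsOpenMap.ball_subset_image_ball {E F : Type*} [NormedAddCommGroup E] [ProperSpace E]
    [NormedAddCommGroup F] [NormedSpace ℝ F] {H : E → F} (hopen : IsOpenMap H)
    (hcont : Continuous H) {z : E} {r ρ : ℝ} (hr : 0 < r) (hρ : 0 < ρ) (hz : H z = 0)
    (hsphere : ∀ w ∈ Metric.sphere z r, ρ ≤ ‖H w‖) :
    Metric.ball 0 ρ ⊆ H '' Metric.ball z r := by
  refine (convex_ball (0 : F) ρ).isPreconnected.subset_of_closure_inter_subset
    (hopen _ Metric.isOpen_ball)
    ⟨0, Metric.mem_ball_self hρ, z, Metric.mem_ball_self hr, hz⟩ ?_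
  rintro y ⟨hy, hyρ⟩
  have hclosed : IsClosed (H '' Metric.closedBall z r) :=
    ((isCompact_closedBall z r).image hcont).isClosed
  obtain ⟨w, hw, rfl⟩ :=
    closure_minimal (Set.image_mono Metric.ball_subset_closedBall) hclosed hy
  refine ⟨w, ?_, rfl⟩
  rw [← Metric.ball_union_sphere] at hw
  refine hw.resolve_right fun hs => ?_
  rw [mem_ball_zero_iff] at hyρ
  exact (hsphere w hs).not_gt hyρ

/-- The Jacobian determinant of `G - (1 - δ) id` is `δ ^ 2` when `G` is unipotent. -/
theorem Unipotent.det_fderiv_add_smul {G : ℝ × ℝ → ℝ × ℝ} (hU : Unipotent G) (δ : ℝ)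
    (w : ℝ × ℝ) :
    (fderiv ℝ G w + (δ - 1) • ContinuousLinearMap.id ℝ (ℝ × ℝ)).det = δ ^ 2 := by
  obtain ⟨htr, hdet⟩ := hU w
  rw [det_prod_real]
  simp
  linear_combination hdet + (δ - 1) * htr

/-- a `C¹` unipotent planar map has no isolated fixed points. -/
theorem statement11 (G : ℝ × ℝ → ℝ × ℝ) (hG : ContDiff ℝ 1 G) (hU : Unipotent G) :
    ∀ z : ℝ × ℝ, G z = z →
      ∀ ε : ℝ, 0 < ε → ∃ w : ℝ × ℝ, w ≠ z ∧ ‖w - z‖ < ε ∧ G w = w := by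
  intro z hz ε hε
  by_contra! hiso
  set r := ε / 2 with hr_def
  have hr : 0 < r := half_pos hε
  obtain ⟨m, hm, hbound⟩ : ∃ m : ℝ, 0 < m ∧ ∀ w ∈ Metric.sphere z r, m ≤ ‖G w - w‖ := by
    obtain ⟨w₀, hw₀, hmin⟩ := (isCompact_sphere z r).exists_isMinOn
      (NormedSpace.sphere_nonempty.2 hr.le)
      (hG.continuous.sub continuous_id).norm.continuousOn
    refine ⟨‖G w₀ - w₀‖, norm_pos_iff.2 (sub_ne_zero.2 (hiso w₀ ?_ ?_)), fun w hw => hmin hw⟩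
    · exact Metric.ne_of_mem_sphere hw₀ hr.ne'
    · rw [mem_sphere_iff_norm.1 hw₀]
      linarith
  set δ := m / (3 * r) with hδ_def
  have hδ : 0 < δ := by positivity
  have hδr : δ * r = m / 3 := by rw [hδ_def]; field_simp
  set H : ℝ × ℝ → ℝ × ℝ := fun w => G w + ((δ - 1) • w - δ • z) with hH
  set H' : ℝ × ℝ → (ℝ × ℝ →L[ℝ] ℝ × ℝ) :=
    fun w => fderiv ℝ G w + (δ - 1) • ContinuousLinearMap.id ℝ (ℝ × ℝ) with hH'
  have hdet (w : ℝ × ℝ) : (H' w).det = δ ^ 2 := hU.det_fderiv_add_smul δ w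
  have hstrict (w : ℝ × ℝ) : HasStrictFDerivAt H (H' w) w :=
    (hG.contDiffAt.hasStrictFDerivAt one_ne_zero).add
      (((hasStrictFDerivAt_id w).const_smul (δ - 1)).sub_const _)
  have hcont : Continuous H :=
    continuous_iff_continuousAt.2 fun w => (hstrict w).continuousAt
  have hopen : IsOpenMap H := by
    refine isOpenMap_iff_nhds_le.2 fun w => ?_
    have hne : (H' w).det ≠ 0 := by rw [hdet]; positivity
    exact (HasStrictFDerivAt.map_nhds_eq_of_equiv
      (f' := (H' w).toContinuousLinearEquivOfDetNeZero hne) (hstrict w)).ge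
  have hHz : H z = 0 := by
    simp only [hH, hz]
    module
  have hsub : Metric.ball 0 (m * (2 / 3)) ⊆ H '' Metric.ball z r := by
    refine hopen.ball_subset_image_ball hcont hr (by positivity) hHz fun w hw => ?_
    have hsplit : G w - w = H w - δ • (w - z) := by
      simp only [hH]
      module
    have hle := norm_sub_le (H w) (δ • (w - z))
    rw [← hsplit, norm_smul, mem_sphere_iff_norm.1 hw, Real.norm_of_nonneg hδ.le, hδr] at hle
    linarith [hbound w hw]
  have hvol : volume (Metric.ball (0 : ℝ × ℝ) (m * (2 / 3))) ≤
      ENNReal.ofReal (δ ^ 2) * volume (Metric.ball z r) := by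
    refine (measure_mono hsub).trans ((addHaar_image_le_lintegral_abs_det_fderiv volume
      Metric.isOpen_ball.measurableSet
      fun w _ => (hstrict w).hasFDerivAt.hasFDerivWithinAt).trans_eq ?_)
    simp [hdet]
  rw [Measure.addHaar_ball _ _ (by positivity), Measure.addHaar_ball _ z hr.le, ← mul_assoc,
    ← ENNReal.ofReal_mul (by positivity),
    ENNReal.mul_le_mul_iff_left (Metric.measure_ball_pos _ _ one_pos).ne' measure_ball_lt_top.ne,
    ENNReal.ofReal_le_ofReal_iff (by positivity)] at hvol
  simp only [Module.finrank_prod, Module.finrank_self] at hvol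
  norm_num at hvol
  rw [← mul_pow, hδr] at hvol
  nlinarith [pow_pos hm 2]
end

section
/- Let G : ℝ² → ℝ² be a continuously differentiable unipotent map which is fixed point free. Then for any pair of points z, w ∈ ℝ², the compact segment Λ = {t·z + (1−t)·w : 0 ≤ t ≤ 1} escapes every compact set in both time directions: for every compact set K ⊆ ℝ² there exists a natural number N such that for all n ≥ N, G^n(Λ) ∩ K = ∅ and Λ ∩ G^n(K) = ∅. -/
open Filter Topology

/-- The linear functional `(x, y) ↦ α x + β y` on the plane. -/
noncomputable def planeForm (α β : ℝ) : ℝ × ℝ →L[ℝ] ℝ :=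
  α • ContinuousLinearMap.fst ℝ ℝ ℝ + β • ContinuousLinearMap.snd ℝ ℝ ℝ

@[simp] theorem planeForm_apply (α β : ℝ) (v : ℝ × ℝ) :
    planeForm α β v = α * v.1 + β * v.2 := by
  simp [planeForm]

/-- The shear `(x, y) ↦ (x, α x + β y)` as a continuous linear equivalence, for `β ≠ 0`. -/
noncomputable def shearEquiv (α β : ℝ) (hβ : β ≠ 0) : (ℝ × ℝ) ≃L[ℝ] ℝ × ℝ :=
  ContinuousLinearEquiv.equivOfInverse
    ((ContinuousLinearMap.fst ℝ ℝ ℝ).prod (planeForm α β))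
    ((ContinuousLinearMap.fst ℝ ℝ ℝ).prod (planeForm (-α / β) (1 / β)))
    (fun v ↦ by ext <;> simp; field_simp; ring)
    (fun v ↦ by ext <;> simp; field_simp; ring)

theorem shearEquiv_symm_apply (α β : ℝ) (hβ : β ≠ 0) (v : ℝ × ℝ) :
    (shearEquiv α β hβ).symm v = (v.1, -α / β * v.1 + 1 / β * v.2) := by
  simp [shearEquiv]

/-- A function whose derivative vanishes on an open interval is constant there. -/
theorem eq_of_hasDerivAt_zero_Ioo {f : ℝ → ℝ} {l u : ℝ}
    (hf : ∀ x ∈ Set.Ioo l u, HasDerivAt f 0 x) {x y : ℝ} (hx : x ∈ Set.Ioo l u)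
    (hy : y ∈ Set.Ioo l u) : f x = f y :=
  isOpen_Ioo.is_const_of_deriv_eq_zero isPreconnected_Ioo
    (fun z hz ↦ (hf z hz).differentiableAt.differentiableWithinAt)
    (fun z hz ↦ (hf z hz).deriv) hx hy

/-- A function whose derivative kills the vector `v` is invariant under translations by
multiples of `v`. -/
theorem apply_add_smul_eq_of_hasFDerivAt {f : ℝ × ℝ → ℝ} {f' : ℝ × ℝ → ℝ × ℝ →L[ℝ] ℝ}
    (hf : ∀ z, HasFDerivAt f (f' z) z) {v : ℝ × ℝ} (hv : ∀ z, f' z v = 0) (z : ℝ × ℝ) (t : ℝ) :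
    f (z + t • v) = f z := by
  have h : ∀ r : ℝ, HasDerivAt (fun r : ℝ ↦ f (z + r • v)) 0 r := fun r ↦ by
    have hl : HasDerivAt (fun r : ℝ ↦ z + r • v) v r := by
      simpa using ((hasDerivAt_id r).smul_const v).const_add z
    exact ((hf (z + r • v)).comp_hasDerivAt r hl).congr_deriv (hv _)
  simpa using is_const_of_deriv_eq_zero (fun r ↦ (h r).differentiableAt) (fun r ↦ (h r).deriv) t 0

section NilpotentField

variable {p q a b c : ℝ × ℝ → ℝ}

/-- If the planar vector field `(p, q)` has nilpotent Jacobian `!![a, b; c, -a]` and `b z ≠ 0`, then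
near `z` the kernel of the Jacobian is constant along the line through `z` it spans, and `1 / b` is
affine on that line. -/
theorem nilpotent_jacobian_local (hp : ContDiff ℝ 1 p)
    (hp' : ∀ z, HasFDerivAt p (planeForm (a z) (b z)) z)
    (hq' : ∀ z, HasFDerivAt q (planeForm (c z) (-a z)) z)
    (hb : Continuous b) (hdet : ∀ z, a z ^ 2 + b z * c z = 0) {z : ℝ × ℝ} {s : ℝ}
    (hbz : b z ≠ 0) (hs : a z + s * b z = 0) :
    ∃ ε > 0, ∃ k : ℝ, ∀ t : ℝ, |t| < ε →
      a (z + t • (1, s)) + s * b (z + t • (1, s)) = 0 ∧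
        b (z + t • (1, s)) * (1 / b z + k * t) = 1 := by
  have hΦ : ContDiff ℝ 1 (fun v : ℝ × ℝ ↦ (v.1, p v)) := contDiff_fst.prodMk hp
  have hΦ' : ∀ v (hv : b v ≠ 0), HasFDerivAt (fun v : ℝ × ℝ ↦ (v.1, p v))
      (shearEquiv (a v) (b v) hv : ℝ × ℝ →L[ℝ] ℝ × ℝ) v := fun v hv ↦
    (hasFDerivAt_fst).prodMk (hp' v)
  set e := hΦ.contDiffAt.toOpenPartialHomeomorph _ (hΦ' z hbz) one_ne_zero
  have hecoe : ∀ v, e v = (v.1, p v) := fun v ↦ rfl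
  have hze : z ∈ e.source := hΦ.contDiffAt.mem_toOpenPartialHomeomorph_source _ _
  obtain ⟨r, hr, hball⟩ : ∃ r > 0, Metric.ball (e z) r ⊆ e.target ∩ e.symm ⁻¹' {v | b v ≠ 0} := by
    refine Metric.isOpen_iff.1 (e.symm.isOpen_inter_preimage (isOpen_ne_fun hb continuous_const))
      (e z) ⟨e.map_source hze, ?_⟩
    simpa [e.left_inv hze] using hbz
  have hbox : ∀ x ∈ Set.Ioo (z.1 - r) (z.1 + r), ∀ y ∈ Set.Ioo (p z - r) (p z + r),
      (x, y) ∈ e.target ∧ b (e.symm (x, y)) ≠ 0 := fun x hx y hy ↦ hball (by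
    rw [Metric.mem_ball, Prod.dist_eq, hecoe, Real.dist_eq, Real.dist_eq]
    exact max_lt (abs_lt.2 ⟨by linarith [hx.1], by linarith [hx.2]⟩)
      (abs_lt.2 ⟨by linarith [hy.1], by linarith [hy.2]⟩))
  have hx0 : z.1 ∈ Set.Ioo (z.1 - r) (z.1 + r) := ⟨by linarith, by linarith⟩
  have hP0 : p z ∈ Set.Ioo (p z - r) (p z + r) := ⟨by linarith, by linarith⟩
  have hsz : e.symm (z.1, p z) = z := by rw [← hecoe, e.left_inv hze]
  have hfst : ∀ x ∈ Set.Ioo (z.1 - r) (z.1 + r), ∀ y ∈ Set.Ioo (p z - r) (p z + r),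
      (e.symm (x, y)).1 = x := fun x hx y hy ↦
    congrArg Prod.fst ((hecoe _).symm.trans (e.right_inv (hbox x hx y hy).1))
  have hsymm : ∀ x (hx : x ∈ Set.Ioo (z.1 - r) (z.1 + r)) y (hy : y ∈ Set.Ioo (p z - r) (p z + r)),
      HasFDerivAt e.symm ((shearEquiv (a (e.symm (x, y))) (b (e.symm (x, y)))
        (hbox x hx y hy).2).symm : ℝ × ℝ →L[ℝ] ℝ × ℝ) (x, y) := fun x hx y hy ↦
    e.hasFDerivAt_symm (hbox x hx y hy).1 (hΦ' _ _)
  have hdx : ∀ x ∈ Set.Ioo (z.1 - r) (z.1 + r), ∀ y ∈ Set.Ioo (p z - r) (p z + r),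
      HasDerivAt (fun x ↦ e.symm (x, y)) (1, -a (e.symm (x, y)) / b (e.symm (x, y))) x :=
    fun x hx y hy ↦ ((hsymm x hx y hy).comp_hasDerivAt x
      ((hasDerivAt_id x).prodMk (hasDerivAt_const x y))).congr_deriv
        (by simp [shearEquiv_symm_apply])
  have hdy : ∀ x ∈ Set.Ioo (z.1 - r) (z.1 + r), ∀ y ∈ Set.Ioo (p z - r) (p z + r),
      HasDerivAt (fun y ↦ e.symm (x, y)) (0, 1 / b (e.symm (x, y))) y :=
    fun x hx y hy ↦ ((hsymm x hx y hy).comp_hasDerivAt y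
      ((hasDerivAt_const y x).prodMk (hasDerivAt_id y))).congr_deriv
        (by simp [shearEquiv_symm_apply])
  have hqconst : ∀ x ∈ Set.Ioo (z.1 - r) (z.1 + r), ∀ y ∈ Set.Ioo (p z - r) (p z + r),
      q (e.symm (x, y)) = q (e.symm (z.1, y)) := fun x hx y hy ↦ by
    refine eq_of_hasDerivAt_zero_Ioo (f := fun x ↦ q (e.symm (x, y))) (fun x hx ↦ ?_) hx hx0
    have h := (hq' (e.symm (x, y))).comp_hasDerivAt x (hdx x hx y hy)
    have h0 : planeForm (c (e.symm (x, y))) (-a (e.symm (x, y)))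
        (1, -a (e.symm (x, y)) / b (e.symm (x, y))) = 0 := by
      have := (hbox x hx y hy).2
      rw [planeForm_apply]
      field_simp
      linear_combination hdet (e.symm (x, y))
    rwa [h0] at h
  have hqdy : ∀ x ∈ Set.Ioo (z.1 - r) (z.1 + r), ∀ y ∈ Set.Ioo (p z - r) (p z + r),
      HasDerivAt (fun y ↦ q (e.symm (x, y))) (-a (e.symm (x, y)) / b (e.symm (x, y))) y :=
    fun x hx y hy ↦ ((hq' (e.symm (x, y))).comp_hasDerivAt y (hdy x hx y hy)).congr_deriv
      (by simp [div_eq_mul_inv])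
  have hslope : ∀ x ∈ Set.Ioo (z.1 - r) (z.1 + r), ∀ y ∈ Set.Ioo (p z - r) (p z + r),
      -a (e.symm (x, y)) / b (e.symm (x, y)) = -a (e.symm (z.1, y)) / b (e.symm (z.1, y)) :=
    fun x hx y hy ↦ by
      refine (hqdy x hx y hy).unique ((hqdy z.1 hx0 y hy).congr_of_eventuallyEq ?_)
      filter_upwards [isOpen_Ioo.mem_nhds hy] with y' hy' using hqconst x hx y' hy'
  have hline : ∀ x ∈ Set.Ioo (z.1 - r) (z.1 + r), ∀ y ∈ Set.Ioo (p z - r) (p z + r),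
      (e.symm (x, y)).2 = (e.symm (z.1, y)).2 +
        (x - z.1) * (-a (e.symm (z.1, y)) / b (e.symm (z.1, y))) := fun x hx y hy ↦ by
    have := eq_of_hasDerivAt_zero_Ioo (f := fun x ↦ (e.symm (x, y)).2 -
        (x - z.1) * (-a (e.symm (z.1, y)) / b (e.symm (z.1, y)))) (fun x hx ↦ ?_) hx hx0
    · simp only [sub_self, zero_mul, sub_zero] at this
      linarith
    · have h1 : HasDerivAt (fun x ↦ (e.symm (x, y)).2) _ x :=
        (hasFDerivAt_snd (𝕜 := ℝ) (p := e.symm (x, y))).comp_hasDerivAt x (hdx x hx y hy)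
      have h2 := ((hasDerivAt_id x).sub_const z.1).mul_const
        (-a (e.symm (z.1, y)) / b (e.symm (z.1, y)))
      exact (h1.sub h2).congr_deriv (by simp [hslope x hx y hy])
  have hYdy : ∀ x ∈ Set.Ioo (z.1 - r) (z.1 + r), ∀ y ∈ Set.Ioo (p z - r) (p z + r),
      HasDerivAt (fun y ↦ (e.symm (x, y)).2) (1 / b (e.symm (x, y))) y := fun x hx y hy ↦
    ((hasFDerivAt_snd (𝕜 := ℝ) (p := e.symm (x, y))).comp_hasDerivAt y (hdy x hx y hy)).congr_deriv
      (by simp)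
  have hs' : -a z / b z = s := by field_simp; linarith
  have hx1 : z.1 + r / 2 ∈ Set.Ioo (z.1 - r) (z.1 + r) := ⟨by linarith, by linarith⟩
  set k := (1 / b (e.symm (z.1 + r / 2, p z)) - 1 / b z) * (2 / r)
  have hSdy : HasDerivAt (fun y ↦ -a (e.symm (z.1, y)) / b (e.symm (z.1, y))) k (p z) := by
    have h := ((hYdy _ hx1 _ hP0).sub (hYdy _ hx0 _ hP0)).mul_const (2 / r)
    rw [hsz] at h
    refine h.congr_of_eventuallyEq ?_
    filter_upwards [isOpen_Ioo.mem_nhds hP0] with y hy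
    have := hline _ hx1 y hy
    simp only [Pi.sub_apply]
    rw [this]
    field_simp
    ring
  refine ⟨r, hr, k, fun t ht ↦ ?_⟩
  obtain ⟨ht1, ht2⟩ := abs_lt.1 ht
  have hx : z.1 + t ∈ Set.Ioo (z.1 - r) (z.1 + r) := ⟨by linarith, by linarith⟩
  have hpt : e.symm (z.1 + t, p z) = z + t • (1, s) := by
    ext
    · simp [hfst _ hx _ hP0]
    · rw [hline _ hx _ hP0, hsz, hs']
      simp
  have hne := (hbox _ hx _ hP0).2
  have hsl := hslope _ hx _ hP0
  rw [hpt] at hne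
  rw [hpt, hsz, hs'] at hsl
  refine ⟨by field_simp at hsl; linarith, ?_⟩
  have hw := hYdy _ hx _ hP0
  have hw' : HasDerivAt (fun y ↦ (e.symm (z.1 + t, y)).2) (1 / b z + t * k) (p z) := by
    have h := (hYdy _ hx0 _ hP0).add (hSdy.const_mul t)
    rw [hsz] at h
    refine h.congr_of_eventuallyEq ?_
    filter_upwards [isOpen_Ioo.mem_nhds hP0] with y hy
    simpa using hline _ hx y hy
  have huniq := hw.unique hw'
  rw [hpt] at huniq
  rw [mul_comm k t, ← huniq]
  field_simp

/-- If the planar vector field `(p, q)` has nilpotent Jacobian `!![a, b; c, -a]` and `b z ≠ 0`, then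
the kernel of the Jacobian is constant along the whole line through `z` it spans, and `b` does not
vanish there. -/
theorem nilpotent_jacobian_line (hp : ContDiff ℝ 1 p)
    (hp' : ∀ z, HasFDerivAt p (planeForm (a z) (b z)) z)
    (hq' : ∀ z, HasFDerivAt q (planeForm (c z) (-a z)) z)
    (ha : Continuous a) (hb : Continuous b) (hdet : ∀ z, a z ^ 2 + b z * c z = 0) {z : ℝ × ℝ}
    {s : ℝ} (hbz : b z ≠ 0) (hs : a z + s * b z = 0) (t : ℝ) :
    a (z + t • (1, s)) + s * b (z + t • (1, s)) = 0 ∧ b (z + t • (1, s)) ≠ 0 := by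
  obtain ⟨ε, hε, κ, hκ⟩ := nilpotent_jacobian_local hp hp' hq' hb hdet hbz hs
  let S : Set ℝ := {t | a (z + t • (1, s)) + s * b (z + t • (1, s)) = 0 ∧
    b (z + t • (1, s)) * (1 / b z + κ * t) = 1}
  have hSclosed : IsClosed S :=
    (isClosed_eq (by fun_prop) continuous_const).inter (isClosed_eq (by fun_prop) continuous_const)
  have hclopen : IsClopen (interior S) := by
    refine ⟨isClosed_of_closure_subset fun t ht ↦ ?_, isOpen_interior⟩
    have htS : t ∈ S := hSclosed.closure_subset_iff.2 interior_subset ht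
    obtain ⟨δ, hδ, k, hk⟩ := nilpotent_jacobian_local hp hp' hq' hb hdet
      (left_ne_zero_of_mul_eq_one htS.2) htS.1
    have hadd : ∀ r, z + t • ((1 : ℝ), s) + (r - t) • ((1 : ℝ), s) = z + r • (1, s) := fun r ↦ by
      rw [add_assoc, ← add_smul]
      ring_nf
    have hkr : ∀ r ∈ Set.Ioo (t - δ) (t + δ), a (z + r • (1, s)) + s * b (z + r • (1, s)) = 0 ∧
        b (z + r • (1, s)) * (1 / b z + κ * t + k * (r - t)) = 1 := fun r hr ↦ by
      have h := hk (r - t) (abs_lt.2 ⟨by linarith [hr.1], by linarith [hr.2]⟩)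
      rwa [hadd, ← eq_one_div_of_mul_eq_one_right htS.2] at h
    have hagree : ∀ r ∈ Set.Ioo (t - δ) (t + δ) ∩ interior S, κ * r = κ * t + k * (r - t) :=
      fun r hr ↦ by
        have h1 := (hkr r hr.1).2
        have h2 := (interior_subset hr.2).2
        have := mul_left_cancel₀ (left_ne_zero_of_mul_eq_one h1) (h1.trans h2.symm)
        linarith
    have hIoo : Set.Ioo (t - δ) (t + δ) ∈ 𝓝 t := Ioo_mem_nhds (by linarith) (by linarith)
    obtain ⟨u, hu⟩ : (Set.Ioo (t - δ) (t + δ) ∩ interior S).Nonempty :=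
      mem_closure_iff_nhds.1 ht _ hIoo
    obtain ⟨η, hη, hηsub⟩ := Metric.isOpen_iff.1 (isOpen_Ioo.inter isOpen_interior) u hu
    have hu' : u + η / 2 ∈ Set.Ioo (t - δ) (t + δ) ∩ interior S :=
      hηsub (by rw [Metric.mem_ball, Real.dist_eq, abs_lt]; constructor <;> linarith)
    have hkκ : k = κ := by
      have h1 := hagree u hu
      have h2 := hagree _ hu'
      exact mul_right_cancel₀ hη.ne' (by linarith)
    refine mem_interior_iff_mem_nhds.2 (Filter.mem_of_superset hIoo fun r hr ↦ ?_)
    have h := hkr r hr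
    rw [hkκ] at h
    exact ⟨h.1, by linear_combination h.2⟩
  have h0 : (0 : ℝ) ∈ interior S := mem_interior_iff_mem_nhds.2 <|
    Filter.mem_of_superset (Ioo_mem_nhds (neg_lt_zero.2 hε) hε) fun t ht ↦ hκ t (abs_lt.2 ht)
  have ht : t ∈ S := interior_subset (by rw [hclopen.eq_univ ⟨0, h0⟩]; trivial)
  exact ⟨ht.1, left_ne_zero_of_mul_eq_one ht.2⟩

/-- A planar vector field `(p, q)` with nilpotent Jacobian `!![a, b; c, -a]` for which `b` is not
identically zero is, up to a constant, everywhere parallel to a fixed vector `(1, s)`, and is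
invariant under translations along that vector. -/
theorem nilpotent_jacobian_structure (hp : ContDiff ℝ 1 p)
    (hp' : ∀ z, HasFDerivAt p (planeForm (a z) (b z)) z)
    (hq' : ∀ z, HasFDerivAt q (planeForm (c z) (-a z)) z)
    (ha : Continuous a) (hb : Continuous b) (hdet : ∀ z, a z ^ 2 + b z * c z = 0) {z₀ : ℝ × ℝ}
    (hb₀ : b z₀ ≠ 0) :
    ∃ s d : ℝ, (∀ z, q z = s * p z + d) ∧ ∀ z (t : ℝ), p (z + t • (1, s)) = p z := by
  set s := -a z₀ / b z₀ with hs
  have hs₀ : a z₀ + s * b z₀ = 0 := by rw [hs]; field_simp; ring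
  have hline := nilpotent_jacobian_line hp hp' hq' ha hb hdet hb₀ hs₀
  have hker : ∀ z, a z + s * b z = 0 := fun z ↦ by
    by_cases hbz : b z = 0
    · have := hdet z
      simp_all
    · obtain ⟨σ, hσ⟩ : ∃ σ, a z + σ * b z = 0 := ⟨-a z / b z, by field_simp; ring⟩
      have hline' := nilpotent_jacobian_line hp hp' hq' ha hb hdet hbz hσ
      suffices h : σ = s by rwa [← h]
      by_contra hne
      have hne' : σ - s ≠ 0 := sub_ne_zero.2 hne
      -- the two lines meet
      obtain ⟨x, hx⟩ : ∃ x, z.2 + (x - z.1) * σ = z₀.2 + (x - z₀.1) * s :=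
        ⟨(z₀.2 - z.2 + z.1 * σ - z₀.1 * s) / (σ - s), by field_simp; ring⟩
      have hmeet : z + (x - z.1) • ((1 : ℝ), σ) = z₀ + (x - z₀.1) • ((1 : ℝ), s) := by
        ext
        · simp
        · simpa using hx
      have h1 := hline (x - z₀.1)
      have h2 := hline' (x - z.1)
      rw [hmeet] at h2
      exact hne (mul_right_cancel₀ h1.2 (by linarith [h1.1, h2.1]))
  have hr' : ∀ z, HasFDerivAt (fun z ↦ q z - s * p z) (planeForm (c z - s * a z) 0) z := fun z ↦ by
    refine ((hq' z).sub ((hp' z).const_mul s)).congr_fderiv ?_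
    ext <;> simp
    linarith [hker z]
  have hvert := apply_add_smul_eq_of_hasFDerivAt hr' (v := (0, 1)) (by simp)
  have hzero : ∀ z, c z - s * a z = 0 := fun z ↦ by
    set w := z₀ + (z.1 - z₀.1) • ((1 : ℝ), s) with hw
    have hwz : w = z + (w.2 - z.2) • ((0 : ℝ), (1 : ℝ)) := by ext <;> simp [hw]
    have hcw : c w - s * a w = 0 := by
      refine mul_left_cancel₀ (hline (z.1 - z₀.1)).2 ?_
      rw [← hw]
      linear_combination hdet w - a w * hker w
    have h : HasFDerivAt (fun z ↦ q z - s * p z) (planeForm (c w - s * a w) 0) z := by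
      have h1 := hr' w
      rw [hwz, ← hwz] at h1
      have h2 : HasFDerivAt (fun v : ℝ × ℝ ↦ v + (w.2 - z.2) • ((0 : ℝ), (1 : ℝ)))
          (ContinuousLinearMap.id ℝ (ℝ × ℝ)) z := (hasFDerivAt_id z).add_const _
      rw [hwz] at h1
      have h3 := h1.comp z h2
      rw [← hwz, ContinuousLinearMap.comp_id] at h3
      exact h3.congr_of_eventuallyEq (.of_forall fun v ↦ (hvert v _).symm)
    have := congrArg (fun L ↦ L (1, 0)) (h.unique (hr' z))
    simp only [planeForm_apply] at this
    linarith
  refine ⟨s, q 0 - s * p 0, fun z ↦ ?_, apply_add_smul_eq_of_hasFDerivAt hp' fun z ↦ by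
    rw [planeForm_apply]; linarith [hker z]⟩
  have := is_const_of_fderiv_eq_zero (fun z ↦ (hr' z).differentiableAt) (fun z ↦ by
    rw [(hr' z).fderiv, hzero]; ext <;> simp) z 0
  linarith

end NilpotentField

/-- If some continuous function `w` increases by `ψ` along the orbits of `G`, where `ψ` is
continuous, `G`-invariant and nowhere zero, then compact sets are wandering under `G`. -/
theorem exists_forall_iterate_image_inter_eq_empty {X : Type*} [TopologicalSpace X] {G : X → X}
    {w ψ : X → ℝ} (hw : Continuous w) (hψ : Continuous ψ) (hψ0 : ∀ z, ψ z ≠ 0)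
    (hψG : ∀ z, ψ (G z) = ψ z) (hwG : ∀ z, w (G z) = w z + ψ z) {A B : Set X}
    (hA : IsCompact A) (hB : IsCompact B) :
    ∃ N : ℕ, ∀ n, N ≤ n → (G^[n] '' A) ∩ B = ∅ := by
  have hiter : ∀ n z, w (G^[n] z) = w z + n * ψ z := fun n ↦ by
    induction n with
    | zero => simp
    | succ n ih =>
      intro z
      rw [Function.iterate_succ_apply, ih, hψG, hwG]
      push_cast
      ring
  obtain ⟨C, hC⟩ := hA.exists_bound_of_continuousOn (f := fun z ↦ w z / ψ z)
    (hw.div hψ hψ0).continuousOn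
  obtain ⟨D, hD⟩ := hA.exists_bound_of_continuousOn (f := fun z ↦ (ψ z)⁻¹)
    (hψ.inv₀ hψ0).continuousOn
  obtain ⟨E, hE⟩ := hB.exists_bound_of_continuousOn (f := w) hw.continuousOn
  obtain ⟨N, hN⟩ := exists_nat_gt (E * D + C)
  refine ⟨N, fun n hn ↦ Set.eq_empty_of_forall_notMem ?_⟩
  rintro _ ⟨⟨z, hz, rfl⟩, hzB⟩
  have h1 := hC z hz
  have h2 := hD z hz
  have h3 := hE _ hzB
  have h4 : (n : ℝ) = w (G^[n] z) * (ψ z)⁻¹ - w z / ψ z := by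
    rw [hiter]
    field_simp [hψ0 z]
    ring
  have h5 : (n : ℝ) ≤ E * D + C := by
    rw [h4]
    calc w (G^[n] z) * (ψ z)⁻¹ - w z / ψ z ≤ ‖w (G^[n] z) * (ψ z)⁻¹ - w z / ψ z‖ := le_abs_self _
      _ ≤ ‖w (G^[n] z)‖ * ‖(ψ z)⁻¹‖ + ‖w z / ψ z‖ := by rw [← norm_mul]; exact norm_sub_le _ _
      _ ≤ E * D + C := add_le_add (mul_le_mul h3 h2 (norm_nonneg _) ((norm_nonneg _).trans h3)) h1
  have : (N : ℝ) ≤ n := by exact_mod_cast hn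
  linarith

/-- A fixed point free `C¹` unipotent planar map is a translation by a nowhere vanishing invariant
amount in a suitable continuous coordinate. -/
theorem Unipotent.exists_translation {G : ℝ × ℝ → ℝ × ℝ} (hG : ContDiff ℝ 1 G) (hU : Unipotent G)
    (hfree : ∀ z : ℝ × ℝ, G z ≠ z) :
    ∃ w ψ : ℝ × ℝ → ℝ, Continuous w ∧ Continuous ψ ∧ (∀ z, ψ z ≠ 0) ∧
      (∀ z, ψ (G z) = ψ z) ∧ ∀ z, w (G z) = w z + ψ z := by
  have hd : ∀ z, HasFDerivAt G (fderiv ℝ G z) z := fun z ↦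
    (hG.differentiable one_ne_zero z).hasFDerivAt
  have hcont : Continuous (fderiv ℝ G) := hG.continuous_fderiv one_ne_zero
  set p : ℝ × ℝ → ℝ := fun z ↦ (G z).1 - z.1 with hpdef
  set q : ℝ × ℝ → ℝ := fun z ↦ (G z).2 - z.2 with hqdef
  set a : ℝ × ℝ → ℝ := fun z ↦ (fderiv ℝ G z (1, 0)).1 - 1 with hadef
  set b : ℝ × ℝ → ℝ := fun z ↦ (fderiv ℝ G z (0, 1)).1 with hbdef
  set c : ℝ × ℝ → ℝ := fun z ↦ (fderiv ℝ G z (1, 0)).2 with hcdef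
  have hp : ContDiff ℝ 1 p := by fun_prop
  have hq : Continuous q := by fun_prop
  have ha : Continuous a := by fun_prop
  have hb : Continuous b := by fun_prop
  have hp' : ∀ z, HasFDerivAt p (planeForm (a z) (b z)) z := fun z ↦ by
    refine ((hd z).fst.sub hasFDerivAt_fst).congr_fderiv ?_
    ext <;> simp [hadef, hbdef]
  have hq' : ∀ z, HasFDerivAt q (planeForm (c z) (-a z)) z := fun z ↦ by
    refine ((hd z).snd.sub hasFDerivAt_snd).congr_fderiv ?_
    ext <;> simp [hadef, hcdef]
    linarith [(hU z).1]
  have hdet : ∀ z, a z ^ 2 + b z * c z = 0 := fun z ↦ by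
    simp only [hadef, hbdef, hcdef]
    linear_combination (fderiv ℝ G z (1, 0)).1 * (hU z).1 - (hU z).2
  have hGpq : ∀ z, G z = (z.1 + p z, z.2 + q z) := fun z ↦ by ext <;> simp [hpdef, hqdef]
  by_cases hb0 : ∀ z, b z = 0
  · have ha0 : ∀ z, a z = 0 := fun z ↦ by simpa [hb0 z] using hdet z
    have hpc : ∀ z, p z = p 0 := fun z ↦
      is_const_of_fderiv_eq_zero (fun z ↦ (hp' z).differentiableAt) (fun z ↦ by
        rw [(hp' z).fderiv, ha0, hb0]; ext <;> simp) z 0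
    by_cases hp0 : p 0 = 0
    · have hq0 : ∀ z, G z = z + q z • ((0 : ℝ), (1 : ℝ)) := fun z ↦ by
        rw [hGpq, hpc, hp0]; ext <;> simp
      refine ⟨Prod.snd, q, continuous_snd, hq, fun z hz ↦ hfree z (by simp [hq0, hz]), fun z ↦ ?_,
        fun z ↦ by simp [hGpq]⟩
      rw [hq0]
      exact apply_add_smul_eq_of_hasFDerivAt hq' (fun z ↦ by simp [ha0]) z _
    · exact ⟨Prod.fst, fun _ ↦ p 0, continuous_fst, continuous_const, fun _ ↦ hp0, fun _ ↦ rfl,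
        fun z ↦ by simp [hGpq, hpc z]⟩
  · push Not at hb0
    obtain ⟨z₀, hz₀⟩ := hb0
    obtain ⟨s, d, hqp, hinv⟩ := nilpotent_jacobian_structure hp hp' hq' ha hb hdet hz₀
    by_cases hd0 : d = 0
    · have hp0 : ∀ z, G z = z + p z • ((1 : ℝ), s) := fun z ↦ by
        rw [hGpq, hqp, hd0]; ext <;> simp [mul_comm]
      refine ⟨Prod.fst, p, continuous_fst, hp.continuous, fun z hz ↦ hfree z (by simp [hp0, hz]),
        fun z ↦ ?_, fun z ↦ by simp [hGpq]⟩
      rw [hp0, hinv]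
    · exact ⟨fun z ↦ z.2 - s * z.1, fun _ ↦ d, by fun_prop, continuous_const, fun _ ↦ hd0,
        fun _ ↦ rfl, fun z ↦ by simp only [hGpq, hqp]; ring⟩

/-- for a fixed point free `C¹` unipotent map, every compact segment
escapes every compact set in both time directions. -/
theorem statement12 (G : ℝ × ℝ → ℝ × ℝ) (hG : ContDiff ℝ 1 G) (hU : Unipotent G)
    (hfree : ∀ z : ℝ × ℝ, G z ≠ z) :
    ∀ z w : ℝ × ℝ, ∀ K : Set (ℝ × ℝ), IsCompact K → ∃ N : ℕ, ∀ n : ℕ, N ≤ n →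
      (G^[n] '' segment ℝ z w) ∩ K = ∅ ∧ segment ℝ z w ∩ (G^[n] '' K) = ∅ := by
  intro z w K hK
  obtain ⟨f, ψ, hf, hψ, hψ0, hψG, hfG⟩ := hU.exists_translation hG hfree
  have hseg : IsCompact (segment ℝ z w) := by
    rw [segment_eq_image_lineMap]
    exact isCompact_Icc.image AffineMap.lineMap_continuous
  obtain ⟨N₁, hN₁⟩ :=
    exists_forall_iterate_image_inter_eq_empty hf hψ hψ0 hψG hfG hseg hK
  obtain ⟨N₂, hN₂⟩ :=
    exists_forall_iterate_image_inter_eq_empty hf hψ hψ0 hψG hfG hK hseg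
  refine ⟨max N₁ N₂, fun n hn ↦ ⟨hN₁ n (le_of_max_le_left hn), ?_⟩⟩
  rw [Set.inter_comm]
  exact hN₂ n (le_of_max_le_right hn)
end

section
/- Let G : ℝ² → ℝ² be a continuously differentiable map which is unipotent, nonlinear, and satisfies G(0,0) = (0,0). For μ ∈ ℝ define G_μ : ℝ² → ℝ² by G_μ(z) = G(z) − μ·z. Then for every μ with 0 < μ < 1, the origin (0,0) is a global attractor for G_μ: G_μ(0,0) = (0,0) and for every z ∈ ℝ², the iterates G_μ^n(z) converge to (0,0) as n → +∞. -/
open Filter Topology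

open Set (Icc Ioo)

/-- If `∂Y/∂x = ∂V/∂s` and `∂V/∂x = 0` on a rectangle, then `Y` is affine in `x`, and so is
`∂Y/∂s`. -/
theorem affine_of_conjugate_derivs {I J : Set ℝ} (hIo : IsOpen I) (hJo : IsOpen J)
    (hIc : IsPreconnected I) {Y V A B : ℝ → ℝ → ℝ}
    (hYx : ∀ x ∈ I, ∀ s ∈ J, HasDerivAt (fun x => Y x s) (A x s) x)
    (hYs : ∀ x ∈ I, ∀ s ∈ J, HasDerivAt (fun s => Y x s) (B x s) s)
    (hVx : ∀ x ∈ I, ∀ s ∈ J, HasDerivAt (fun x => V x s) 0 x)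
    (hVs : ∀ x ∈ I, ∀ s ∈ J, HasDerivAt (fun s => V x s) (A x s) s)
    {x₀ : ℝ} (hx₀ : x₀ ∈ I) :
    (∀ x ∈ I, ∀ s ∈ J, V x s = V x₀ s ∧ A x s = A x₀ s ∧
      Y x s = Y x₀ s + A x₀ s * (x - x₀)) ∧
    ∀ s ∈ J, ∃ a k, ∀ x ∈ I, B x s = a + k * x := by
  have hV : ∀ x ∈ I, ∀ s ∈ J, V x s = V x₀ s := fun x hx s hs =>
    hIo.is_const_of_deriv_eq_zero hIc
      (fun y hy => (hVx y hy s hs).differentiableAt.differentiableWithinAt)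
      (fun y hy => (hVx y hy s hs).deriv) hx hx₀
  have hA : ∀ x ∈ I, ∀ s ∈ J, A x s = A x₀ s := by
    intro x hx s hs
    refine (hVs x hx s hs).unique ((hVs x₀ hx₀ s hs).congr_of_eventuallyEq ?_)
    filter_upwards [hJo.mem_nhds hs] with s' hs' using hV x hx s' hs'
  have hY : ∀ x ∈ I, ∀ s ∈ J, Y x s = Y x₀ s + A x₀ s * (x - x₀) := by
    intro x hx s hs
    have hd : ∀ y ∈ I, HasDerivAt (fun y => Y y s - A x₀ s * (y - x₀)) 0 y := by
      intro y hy
      have h : HasDerivAt (fun y => Y y s - A x₀ s * (y - x₀)) (A y s - A x₀ s * 1) y :=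
        (hYx y hy s hs).sub (((hasDerivAt_id y).sub_const x₀).const_mul (A x₀ s))
      rw [hA y hy s hs] at h
      simpa using h
    have h := hIo.is_const_of_deriv_eq_zero hIc
      (fun y hy => (hd y hy).differentiableAt.differentiableWithinAt)
      (fun y hy => (hd y hy).deriv) hx hx₀
    simp only [sub_self, mul_zero, sub_zero] at h
    linarith
  refine ⟨fun x hx s hs => ⟨hV x hx s hs, hA x hx s hs, hY x hx s hs⟩, fun s hs => ?_⟩
  obtain ⟨x₁, hx₁, hne⟩ : ∃ x₁ ∈ I, x₁ ≠ x₀ := by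
    have h₁ : ∀ᶠ y in 𝓝[≠] x₀, y ∈ I := mem_nhdsWithin_of_mem_nhds (hIo.mem_nhds hx₀)
    have h₂ : ∀ᶠ y in 𝓝[≠] x₀, y ≠ x₀ := self_mem_nhdsWithin
    exact (h₁.and h₂).exists
  have hne' : x₁ - x₀ ≠ 0 := sub_ne_zero.2 hne
  have key : ∀ x ∈ I, B x s = B x₀ s + (x - x₀) / (x₁ - x₀) * (B x₁ s - B x₀ s) := by
    intro x hx
    refine (hYs x hx s hs).unique (((hYs x₀ hx₀ s hs).add (((hYs x₁ hx₁ s hs).sub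
      (hYs x₀ hx₀ s hs)).const_mul ((x - x₀) / (x₁ - x₀)))).congr_of_eventuallyEq ?_)
    filter_upwards [hJo.mem_nhds hs] with s' hs'
    simp only [Pi.add_apply, Pi.sub_apply]
    rw [hY x hx s' hs', hY x₁ hx₁ s' hs']
    field_simp
    ring
  refine ⟨B x₀ s - x₀ / (x₁ - x₀) * (B x₁ s - B x₀ s), (B x₁ s - B x₀ s) / (x₁ - x₀), ?_⟩
  intro x hx
  rw [key x hx]
  field_simp
  ring

theorem tendsto_zero_of_contracting {E : Type*} [NormedAddCommGroup E] [NormedSpace ℝ E]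
    {c : ℝ} (hc : 0 < c) (hc1 : c < 1) {z e : ℕ → E} (he : Tendsto e atTop (𝓝 0))
    (hz : ∀ n, z (n + 1) = c • z n + e n) : Tendsto z atTop (𝓝 0) := by
  rw [Metric.tendsto_atTop]
  intro ε hε
  obtain ⟨N, hN⟩ := Metric.tendsto_atTop.1 he ((1 - c) * (ε / 2)) (by
    have : 0 < 1 - c := by linarith
    positivity)
  have hb : ∀ k, ‖z (N + k)‖ ≤ c ^ k * ‖z N‖ + ε / 2 := by
    intro k
    induction k with
    | zero => simp; linarith
    | succ k ih =>
      have h1 := hN (N + k) (by omega)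
      rw [dist_zero_right] at h1
      calc ‖z (N + (k + 1))‖ = ‖c • z (N + k) + e (N + k)‖ := by rw [← hz]; rfl
        _ ≤ c * ‖z (N + k)‖ + ‖e (N + k)‖ := by
          refine (norm_add_le _ _).trans_eq ?_
          rw [norm_smul, Real.norm_of_nonneg hc.le]
        _ ≤ c * (c ^ k * ‖z N‖ + ε / 2) + (1 - c) * (ε / 2) := by gcongr
        _ = _ := by ring
  have ht : Tendsto (fun k => c ^ k * ‖z N‖) atTop (𝓝 0) := by
    simpa using (tendsto_pow_atTop_nhds_zero_of_lt_one hc.le hc1).mul_const ‖z N‖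
  obtain ⟨M, hM⟩ := (ht.eventually_lt_const (half_pos hε)).exists_forall_of_atTop
  refine ⟨N + M, fun n hn => ?_⟩
  obtain ⟨k, rfl⟩ := Nat.exists_eq_add_of_le (show N ≤ n by omega)
  rw [dist_zero_right]
  have := hM k (by omega)
  linarith [hb k]

theorem exists_Ioo_subset_of_Icc_subset {α β : ℝ} (hαβ : α ≤ β) {U : Set ℝ} (hU : IsOpen U)
    (h : Icc α β ⊆ U) : ∃ ε > 0, Ioo (α - ε) (β + ε) ⊆ U := by
  obtain ⟨ε₁, h₁, hα⟩ := Metric.isOpen_iff.1 hU α (h ⟨le_rfl, hαβ⟩)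
  obtain ⟨ε₂, h₂, hβ⟩ := Metric.isOpen_iff.1 hU β (h ⟨hαβ, le_rfl⟩)
  refine ⟨min ε₁ ε₂, lt_min h₁ h₂, fun x hx => ?_⟩
  have l₁ := min_le_left ε₁ ε₂
  have l₂ := min_le_right ε₁ ε₂
  obtain ⟨hx₁, hx₂⟩ := hx
  rcases lt_or_ge x α with hlt | hge
  · apply hα
    rw [Real.ball_eq_Ioo]
    constructor <;> linarith
  rcases lt_or_ge β x with hgt | hle
  · apply hβ
    rw [Real.ball_eq_Ioo]
    constructor <;> linarith
  exact h ⟨hge, hle⟩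

/-- A function vanishing and increasing across a horizontal segment takes all small values on
each short vertical segment crossing a neighbourhood of it. -/
theorem exists_rectangle {u b : ℝ × ℝ → ℝ} (hu : Continuous u) (hb : Continuous b)
    (hub : ∀ x y, HasDerivAt (fun y => u (x, y)) (b (x, y)) y) {α β : ℝ} (hαβ : α ≤ β)
    (h0 : ∀ x ∈ Icc α β, u (x, 0) = 0) (hpos : ∀ x ∈ Icc α β, 0 < b (x, 0)) :
    ∃ ε > 0, ∃ η > 0, ∃ s₀ > 0, ∀ x ∈ Ioo (α - ε) (β + ε),
      (∀ y ∈ Ioo (-η) η, 0 < b (x, y)) ∧ StrictMonoOn (fun y => u (x, y)) (Ioo (-η) η) ∧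
      ∀ s ∈ Ioo (-s₀) s₀, ∃ y ∈ Ioo (-η) η, u (x, y) = s := by
  have mono : ∀ x (D : Set ℝ), Convex ℝ D → (∀ y ∈ D, 0 < b (x, y)) →
      StrictMonoOn (fun y => u (x, y)) D := fun x D hD h =>
    strictMonoOn_of_deriv_pos hD (by fun_prop) fun y hy => by
      rw [(hub x y).deriv]
      exact h y (interior_subset hy)
  obtain ⟨U, W, hU, hW, hIU, h0W, hUW⟩ := generalized_tube_lemma (isCompact_Icc (a := α) (b := β))
    (isCompact_singleton (x := (0 : ℝ))) (isOpen_lt continuous_const hb : IsOpen {z | 0 < b z})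
    (by rintro ⟨x, y⟩ ⟨hx, hy⟩; obtain rfl : y = 0 := hy; exact hpos x hx)
  obtain ⟨η, hη, hηW⟩ := Metric.isOpen_iff.1 hW 0 (h0W rfl)
  rw [Real.ball_eq_Ioo, zero_sub, zero_add] at hηW
  have hbpos : ∀ x ∈ U, ∀ y ∈ Ioo (-η) η, 0 < b (x, y) := fun x hx y hy =>
    hUW (Set.mk_mem_prod hx (hηW hy))
  have hcont : Continuous fun x => min (u (x, η / 2)) (-u (x, -(η / 2))) := by fun_prop
  obtain ⟨m, hm, hmin⟩ := isCompact_Icc.exists_isMinOn ⟨α, le_rfl, hαβ⟩ hcont.continuousOn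
  have hmpos : 0 < min (u (m, η / 2)) (-u (m, -(η / 2))) := by
    have hmono := mono m _ (convex_Ioo _ _) (hbpos m (hIU hm))
    have e₁ := hmono (a := 0) (b := η / 2) ⟨by linarith, by linarith⟩
      ⟨by linarith, by linarith⟩ (by linarith)
    have e₂ := hmono (a := -(η / 2)) (b := 0) ⟨by linarith, by linarith⟩
      ⟨by linarith, by linarith⟩ (by linarith)
    simp only [h0 m hm] at e₁ e₂
    exact lt_min e₁ (by linarith)
  set s₁ := min (u (m, η / 2)) (-u (m, -(η / 2))) with hs₁
  obtain ⟨ε, hε, hεU⟩ := exists_Ioo_subset_of_Icc_subset hαβ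
    (hU.inter (isOpen_lt continuous_const hcont : IsOpen {x | s₁ / 2 < _}))
    (fun x hx => ⟨hIU hx, (half_lt_self hmpos).trans_le (hmin hx)⟩)
  refine ⟨ε, hε, η, hη, s₁ / 2, half_pos hmpos, fun x hx => ?_⟩
  obtain ⟨hxU, hxs⟩ := hεU hx
  obtain ⟨k₁, k₂⟩ := lt_min_iff.1 (show s₁ / 2 < min _ _ from hxs)
  refine ⟨hbpos x hxU, mono x _ (convex_Ioo _ _) (hbpos x hxU), fun s hs => ?_⟩
  have hsu : s ∈ Icc (u (x, -(η / 2))) (u (x, η / 2)) :=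
    ⟨by linarith [hs.1], by linarith [hs.2]⟩
  obtain ⟨y, hy, rfl⟩ := intermediate_value_Icc (a := -(η / 2)) (b := η / 2) (by linarith)
    (f := fun y => u (x, y)) (by fun_prop) hsu
  exact ⟨y, ⟨by linarith [hy.1], by linarith [hy.2]⟩, rfl⟩

/-- The shear-like equivalence `(x, y) ↦ (x, p x + b y)`. -/
noncomputable def triangularEquiv (p b : ℝ) (hb : b ≠ 0) : (ℝ × ℝ) ≃L[ℝ] ℝ × ℝ :=
  ContinuousLinearEquiv.equivOfInverse
    ((ContinuousLinearMap.fst ℝ ℝ ℝ).prod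
      (p • ContinuousLinearMap.fst ℝ ℝ ℝ + b • ContinuousLinearMap.snd ℝ ℝ ℝ))
    ((ContinuousLinearMap.fst ℝ ℝ ℝ).prod
      (b⁻¹ • (ContinuousLinearMap.snd ℝ ℝ ℝ - p • ContinuousLinearMap.fst ℝ ℝ ℝ)))
    (fun z => by ext <;> simp [hb])
    (fun z => by ext <;> simp [hb])

theorem apply_eq_smul_add_smul (L : ℝ × ℝ →L[ℝ] ℝ × ℝ) (w : ℝ × ℝ) :
    L w = w.1 • L (1, 0) + w.2 • L (0, 1) := by
  rw [← map_smul, ← map_smul, ← map_add]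
  simp

/-- Entries of a square-zero map with nonvanishing upper right entry. -/
theorem entries_of_sq_eq_zero {L : ℝ × ℝ →L[ℝ] ℝ × ℝ} (hL : ∀ w, L (L w) = 0)
    (hb : (L (0, 1)).1 ≠ 0) :
    (L (0, 1)).2 = -(L (1, 0)).1 ∧ (L (1, 0)).2 = -(L (1, 0)).1 ^ 2 / (L (0, 1)).1 := by
  have h₁ := hL (1, 0)
  have h₂ := hL (0, 1)
  rw [apply_eq_smul_add_smul L (L _)] at h₁ h₂
  have e₁ := congrArg Prod.fst h₁
  have e₂ := congrArg Prod.fst h₂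
  simp only [Prod.fst_add, Prod.smul_fst, smul_eq_mul, Prod.fst_zero] at e₁ e₂
  constructor
  · have : (L (0, 1)).1 * ((L (1, 0)).1 + (L (0, 1)).2) = 0 := by linarith
    rcases mul_eq_zero.1 this with h | h
    · exact absurd h hb
    · linarith
  · field_simp
    linarith

theorem hasDerivAt_mk_right {F : Type*} [NormedAddCommGroup F] [NormedSpace ℝ F]
    {f : ℝ × ℝ → F} {f' : ℝ × ℝ →L[ℝ] F} {x y : ℝ} (h : HasFDerivAt f f' (x, y)) :
    HasDerivAt (fun y => f (x, y)) (f' (0, 1)) y :=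
  h.comp_hasDerivAt y ((hasDerivAt_const y x).prodMk (hasDerivAt_id y))

theorem hasDerivAt_mk_left {F : Type*} [NormedAddCommGroup F] [NormedSpace ℝ F]
    {f : ℝ × ℝ → F} {f' : ℝ × ℝ →L[ℝ] F} {x y : ℝ} (h : HasFDerivAt f f' (x, y)) :
    HasDerivAt (fun x => f (x, y)) (f' (1, 0)) x :=
  h.comp_hasDerivAt x ((hasDerivAt_id x).prodMk (hasDerivAt_const x y))

/-- If a map with square-zero derivative vanishes on a horizontal segment, transversally to it, then
it does so on a longer one, and the reciprocal of its transversal derivative is affine there. -/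
theorem exists_Ioo_of_segment {H : ℝ × ℝ → ℝ × ℝ} (hH : ContDiff ℝ 1 H)
    (hN : ∀ z w, fderiv ℝ H z (fderiv ℝ H z w) = 0) {α β : ℝ} (hαβ : α ≤ β)
    (h0 : ∀ x ∈ Icc α β, H (x, 0) = 0)
    (hpos : ∀ x ∈ Icc α β, 0 < (fderiv ℝ H (x, 0) (0, 1)).1)
    (hker : fderiv ℝ H (α, 0) (1, 0) = 0) :
    ∃ ε > 0, ∃ a k : ℝ, ∀ x ∈ Ioo (α - ε) (β + ε), H (x, 0) = 0 ∧
      fderiv ℝ H (x, 0) (1, 0) = 0 ∧ 0 < (fderiv ℝ H (x, 0) (0, 1)).1 ∧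
      (fderiv ℝ H (x, 0) (0, 1)).1 * (a + k * x) = 1 := by
  have hd : ∀ z, HasStrictFDerivAt H (fderiv ℝ H z) z := fun z => hH.hasStrictFDerivAt one_ne_zero
  have hDc : Continuous (fderiv ℝ H) := hH.continuous_fderiv one_ne_zero
  obtain ⟨ε, hε, η, hη, s₀, hs₀, hrect⟩ := exists_rectangle (u := fun z => (H z).1)
    (b := fun z => (fderiv ℝ H z (0, 1)).1) (continuous_fst.comp hH.continuous) (by fun_prop)
    (fun x y => hasDerivAt_mk_right (hd (x, y)).hasFDerivAt.fst) hαβ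
    (fun x hx => by simp [h0 x hx]) hpos
  set I := Ioo (α - ε) (β + ε) with hI
  set J := Ioo (-s₀) s₀ with hJ
  have hex : ∀ x s, ∃ y, x ∈ I → s ∈ J → y ∈ Ioo (-η) η ∧ (H (x, y)).1 = s := by
    intro x s
    by_cases h : x ∈ I ∧ s ∈ J
    · obtain ⟨y, hy, hys⟩ := (hrect x h.1).2.2 s h.2
      exact ⟨y, fun _ _ => ⟨hy, hys⟩⟩
    · exact ⟨0, fun h₁ h₂ => absurd ⟨h₁, h₂⟩ h⟩
  choose Y hY using hex
  have huniq : ∀ x ∈ I, ∀ y ∈ Ioo (-η) η, (H (x, y)).1 ∈ J → Y x (H (x, y)).1 = y := by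
    intro x hx y hy hs
    obtain ⟨h₁, h₂⟩ := hY x _ hx hs
    exact (hrect x hx).2.1.injOn h₁ hy h₂
  have hbne : ∀ x ∈ I, ∀ s ∈ J, (fderiv ℝ H (x, Y x s) (0, 1)).1 ≠ 0 := fun x hx s hs =>
    ((hrect x hx).1 _ (hY x s hx hs).1).ne'
  have hΨ : ∀ x (hx : x ∈ I) s (hs : s ∈ J),
      HasFDerivAt (fun q : ℝ × ℝ => (q.1, Y q.1 q.2))
        ((triangularEquiv (fderiv ℝ H (x, Y x s) (1, 0)).1 _ (hbne x hx s hs)).symm :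
          ℝ × ℝ →L[ℝ] ℝ × ℝ) (x, s) := by
    intro x hx s hs
    obtain ⟨hy, hys⟩ := hY x s hx hs
    have hΘ : HasStrictFDerivAt (fun z : ℝ × ℝ => (z.1, (H z).1))
        (triangularEquiv (fderiv ℝ H (x, Y x s) (1, 0)).1 _ (hbne x hx s hs) :
          ℝ × ℝ →L[ℝ] ℝ × ℝ) (x, Y x s) := by
      refine (hasStrictFDerivAt_fst.prodMk (hd (x, Y x s)).fst).congr_fderiv ?_
      refine ContinuousLinearMap.ext fun w => ?_
      have := apply_eq_smul_add_smul (fderiv ℝ H (x, Y x s)) w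
      ext
      · simp [triangularEquiv]
      · simp [triangularEquiv, this, mul_comm]
    have := hΘ.to_local_left_inverse (g := fun q : ℝ × ℝ => (q.1, Y q.1 q.2)) ?_
    · simpa only [hys] using this.hasFDerivAt
    have c₁ : ∀ᶠ z : ℝ × ℝ in 𝓝 (x, Y x s), z.1 ∈ I :=
      continuous_fst.continuousAt.eventually (isOpen_Ioo.mem_nhds hx)
    have c₂ : ∀ᶠ z : ℝ × ℝ in 𝓝 (x, Y x s), z.2 ∈ Ioo (-η) η :=
      continuous_snd.continuousAt.eventually (isOpen_Ioo.mem_nhds hy)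
    have c₃ : ∀ᶠ z : ℝ × ℝ in 𝓝 (x, Y x s), (H z).1 ∈ J :=
      (continuous_fst.comp hH.continuous).continuousAt.eventually
        (isOpen_Ioo.mem_nhds (by simpa only [Function.comp, hys] using hs))
    filter_upwards [c₁, c₂, c₃] with z h₁ h₂ h₃
    exact Prod.ext rfl (huniq z.1 h₁ z.2 h₂ h₃)
  have hVΨ : ∀ x (hx : x ∈ I) s (hs : s ∈ J),
      HasFDerivAt (fun q : ℝ × ℝ => (H (q.1, Y q.1 q.2)).2)
        (((ContinuousLinearMap.snd ℝ ℝ ℝ).comp (fderiv ℝ H (x, Y x s))).comp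
          ((triangularEquiv (fderiv ℝ H (x, Y x s) (1, 0)).1 _ (hbne x hx s hs)).symm :
            ℝ × ℝ →L[ℝ] ℝ × ℝ)) (x, s) := fun x hx s hs =>
    HasFDerivAt.comp (g := fun z => (H z).2) (x, s) (hd (x, Y x s)).hasFDerivAt.snd (hΨ x hx s hs)
  have hαI : α ∈ I := ⟨by linarith, by linarith⟩
  have h0J : (0 : ℝ) ∈ J := ⟨by linarith, by linarith⟩
  obtain ⟨hconst, haff⟩ := affine_of_conjugate_derivs (I := I) (J := J) isOpen_Ioo isOpen_Ioo
    isPreconnected_Ioo (Y := Y) (V := fun x s => (H (x, Y x s)).2)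
    (A := fun x s => -(fderiv ℝ H (x, Y x s) (1, 0)).1 / (fderiv ℝ H (x, Y x s) (0, 1)).1)
    (B := fun x s => ((fderiv ℝ H (x, Y x s) (0, 1)).1)⁻¹)
    (fun x hx s hs => (hasDerivAt_mk_left (hΨ x hx s hs).snd).congr_deriv (by
      simp [triangularEquiv, div_eq_inv_mul]))
    (fun x hx s hs => (hasDerivAt_mk_right (hΨ x hx s hs).snd).congr_deriv (by
      simp [triangularEquiv]))
    (fun x hx s hs => (hasDerivAt_mk_left (hVΨ x hx s hs)).congr_deriv (by
        have hb := hbne x hx s hs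
        obtain ⟨e₁, e₂⟩ := entries_of_sq_eq_zero (hN (x, Y x s)) hb
        simp [triangularEquiv]
        rw [apply_eq_smul_add_smul]
        simp [e₁, e₂]
        field_simp
        ring))
    (fun x hx s hs => (hasDerivAt_mk_right (hVΨ x hx s hs)).congr_deriv (by
        have hb := hbne x hx s hs
        obtain ⟨e₁, e₂⟩ := entries_of_sq_eq_zero (hN (x, Y x s)) hb
        simp [triangularEquiv]
        rw [apply_eq_smul_add_smul]
        simp [e₁]
        field_simp))
    hαI
  obtain ⟨a, k, hak⟩ := haff 0 h0J
  have hHα : H (α, 0) = 0 := h0 α ⟨le_rfl, hαβ⟩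
  have hYα : Y α 0 = 0 := by
    have := huniq α hαI 0 ⟨by linarith, by linarith⟩ (by rw [hHα]; exact h0J)
    rwa [hHα] at this
  refine ⟨ε, hε, a, k, fun x hx => ?_⟩
  obtain ⟨hV, hA, hYx⟩ := hconst x hx 0 h0J
  have hb := hbne x hx 0 h0J
  simp only [hYα, hker, Prod.fst_zero, neg_zero, zero_div, zero_mul, add_zero] at hYx hA hV
  have hu := (hY x 0 hx h0J).2
  have hakx := hak x hx
  simp only [hYx] at hu hA hV hakx hb
  have ha : (fderiv ℝ H (x, 0) (1, 0)).1 = 0 := by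
    rcases div_eq_zero_iff.1 hA with h | h
    · linarith
    · exact absurd h hb
  refine ⟨Prod.ext hu (by rw [hV, hHα]), Prod.ext ha ?_,
    (hrect x hx).1 0 ⟨by linarith, by linarith⟩, ?_⟩
  · rw [(entries_of_sq_eq_zero (hN (x, 0)) hb).2, ha]
    simp
  · rw [← hakx, mul_inv_cancel₀ hb]

theorem eq_zero_on_axis {H : ℝ × ℝ → ℝ × ℝ} (hH : ContDiff ℝ 1 H)
    (hN : ∀ z w, fderiv ℝ H z (fderiv ℝ H z w) = 0) (h0 : H (0, 0) = 0)
    (hker : fderiv ℝ H (0, 0) (1, 0) = 0) (hpos : 0 < (fderiv ℝ H (0, 0) (0, 1)).1) (x : ℝ) :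
    H (x, 0) = 0 := by
  have hDc : Continuous (fderiv ℝ H) := hH.continuous_fderiv one_ne_zero
  have hHc : Continuous H := hH.continuous
  obtain ⟨ε, hε, a, k, hloc⟩ := exists_Ioo_of_segment hH hN (α := 0) (β := 0) le_rfl
    (fun x hx => by obtain rfl : x = 0 := le_antisymm hx.2 hx.1; exact h0)
    (fun x hx => by obtain rfl : x = 0 := le_antisymm hx.2 hx.1; exact hpos) hker
  set C : Set ℝ := {t | H (t, 0) = 0 ∧ fderiv ℝ H (t, 0) (1, 0) = 0 ∧
    0 ≤ (fderiv ℝ H (t, 0) (0, 1)).1 ∧ (fderiv ℝ H (t, 0) (0, 1)).1 * (a + k * t) = 1} with hC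
  have hCc : IsClosed C := by
    simp only [hC, Set.ofPred_and]
    refine (isClosed_eq ?_ ?_).inter ((isClosed_eq ?_ ?_).inter
      ((isClosed_le ?_ ?_).inter (isClosed_eq ?_ ?_))) <;> fun_prop
  set S : Set ℝ := {X | ∀ θ ∈ Icc (-1 : ℝ) 1, θ * X ∈ C} with hS
  have hSc : IsClosed S := by
    have : S = ⋂ θ ∈ Icc (-1 : ℝ) 1, (fun X => θ * X) ⁻¹' C := by ext; simp [hS]
    rw [this]
    exact isClosed_biInter fun θ _ => hCc.preimage (by fun_prop)
  have hSmem : ∀ X, 0 < X → (X ∈ S ↔ Icc (-X) X ⊆ C) := by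
    intro X hX
    constructor
    · intro h t ht
      have := h (t / X) ⟨by rw [le_div_iff₀ hX]; linarith [ht.1],
        by rw [div_le_iff₀ hX]; linarith [ht.2]⟩
      rwa [div_mul_cancel₀ _ hX.ne'] at this
    · intro h θ hθ
      exact h ⟨by nlinarith [hθ.1], by nlinarith [hθ.2]⟩
  have hτ : 0 < ε / 2 := half_pos hε
  have hτS : ε / 2 ∈ S := by
    rw [hSmem _ hτ]
    intro t ht
    obtain ⟨h₁, h₂, h₃, h₄⟩ := hloc t ⟨by linarith [ht.1], by linarith [ht.2]⟩
    exact ⟨h₁, h₂, h₃.le, h₄⟩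
  have hall : Icc (ε / 2) (ε / 2 + |x|) ⊆ S := by
    refine (hSc.inter isClosed_Icc).Icc_subset_of_forall_exists_gt hτS ?_
    rintro X ⟨hXS, hX₁, -⟩ y hy
    have hX : 0 < X := hτ.trans_le hX₁
    have hXC := (hSmem X hX).1 hXS
    obtain ⟨ε', hε', a', k', hloc'⟩ := exists_Ioo_of_segment hH hN (α := -X) (β := X)
      (by linarith) (fun t ht => (hXC ht).1)
      (fun t ht => (hXC ht).2.2.1.lt_of_ne fun h => by
        have := (hXC ht).2.2.2
        rw [← h, zero_mul] at this
        exact zero_ne_one this)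
      (hXC ⟨le_rfl, by linarith⟩).2.1
    have agree : ∀ t ∈ Icc (-X) X, a + k * t = a' + k' * t := by
      intro t ht
      obtain ⟨-, -, hb, hb'⟩ := hloc' t ⟨by linarith [ht.1], by linarith [ht.2]⟩
      exact mul_left_cancel₀ hb.ne' ((hXC ht).2.2.2.trans hb'.symm)
    have ea := agree 0 ⟨by linarith, hX.le⟩
    have ek := agree X ⟨by linarith, le_rfl⟩
    obtain rfl : a = a' := by simpa using ea
    obtain rfl : k = k' := mul_right_cancel₀ hX.ne' (by linarith)
    have hm₁ := min_le_left y (X + ε' / 2)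
    have hm₂ := min_le_right y (X + ε' / 2)
    have hm : X < min y (X + ε' / 2) := lt_min hy (by linarith)
    refine ⟨min y (X + ε' / 2), (hSmem _ (hX.trans hm)).2 fun t ht => ?_, hm, hm₁⟩
    obtain ⟨h₁, h₂, h₃, h₄⟩ := hloc' t ⟨by linarith [ht.1], by linarith [ht.2]⟩
    exact ⟨h₁, h₂, h₃.le, h₄⟩
  have hxS := hall ⟨le_add_of_nonneg_right (abs_nonneg x), le_rfl⟩
  refine ((hSmem _ (by positivity)).1 hxS ⟨?_, ?_⟩).1
  · linarith [neg_abs_le x]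
  · linarith [le_abs_self x]

/-- Through each point where the derivative does not vanish there passes a line on which a map
with square-zero derivative is constant. -/
theorem exists_line {H : ℝ × ℝ → ℝ × ℝ} (hH : ContDiff ℝ 1 H)
    (hN : ∀ z w, fderiv ℝ H z (fderiv ℝ H z w) = 0) {p : ℝ × ℝ} (hp : fderiv ℝ H p ≠ 0) :
    ∃ d : ℝ × ℝ, d ≠ 0 ∧ ∀ t : ℝ, H (p + t • d) = H p := by
  obtain ⟨f, hf⟩ : ∃ f, fderiv ℝ H p f ≠ 0 := by
    by_contra! h
    exact hp (ContinuousLinearMap.ext h)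
  set e := fderiv ℝ H p f with he
  let L : ℝ × ℝ →ₗ[ℝ] ℝ × ℝ :=
    (LinearMap.fst ℝ ℝ ℝ).smulRight e + (LinearMap.snd ℝ ℝ ℝ).smulRight f
  have hL : ∀ w, L w = w.1 • e + w.2 • f := fun w => rfl
  have hinj : Function.Injective L := by
    rw [injective_iff_map_eq_zero]
    intro w hw
    rw [hL] at hw
    have h₂ : w.2 = 0 := by
      have := congrArg (fderiv ℝ H p) hw
      rw [map_add, map_smul, map_smul, he, hN, smul_zero, zero_add, map_zero, ← he] at this
      exact (smul_eq_zero.1 this).resolve_right hf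
    rw [h₂, zero_smul, add_zero] at hw
    exact Prod.ext ((smul_eq_zero.1 hw).resolve_right hf) h₂
  let A : (ℝ × ℝ) ≃L[ℝ] ℝ × ℝ := (LinearEquiv.ofInjectiveEndo L hinj).toContinuousLinearEquiv
  have hA : ∀ w, A w = w.1 • e + w.2 • f := hL
  have hAe : A (1, 0) = e := by simp [hA]
  have hAf : A (0, 1) = f := by simp [hA]
  set K : ℝ × ℝ → ℝ × ℝ := fun w => A.symm (H (p + A w) - H p) with hK
  have hKd : ∀ w, fderiv ℝ K w = (A.symm : ℝ × ℝ →L[ℝ] ℝ × ℝ).comp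
      ((fderiv ℝ H (p + A w)).comp (A : ℝ × ℝ →L[ℝ] ℝ × ℝ)) := by
    intro w
    have h₁ : HasFDerivAt (fun w => p + A w) (A : ℝ × ℝ →L[ℝ] ℝ × ℝ) w :=
      A.hasFDerivAt.const_add p
    have h₂ := ((hH.differentiable one_ne_zero (p + A w)).hasFDerivAt.comp w h₁).sub_const (H p)
    exact ((A.symm.hasFDerivAt (x := H (p + A w) - H p)).comp w h₂).fderiv
  have hK0 : fderiv ℝ K (0, 0) = (A.symm : ℝ × ℝ →L[ℝ] ℝ × ℝ).comp
      ((fderiv ℝ H p).comp (A : ℝ × ℝ →L[ℝ] ℝ × ℝ)) := by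
    rw [hKd, Prod.mk_zero_zero, map_zero, add_zero]
  have hKN : ∀ z w, fderiv ℝ K z (fderiv ℝ K z w) = 0 := by
    intro z w
    simp [hKd, hN]
  have hKC : ContDiff ℝ 1 K := by fun_prop
  refine ⟨e, hf, fun t => ?_⟩
  have := eq_zero_on_axis hKC hKN (by simp [hK, ← Prod.zero_eq_mk]) (by simp [hK0, hAe, he, hN])
    (by
      have : A.symm e = (1, 0) := by rw [← hAe, A.symm_apply_apply]
      simp [hK0, hAf, ← he, this]) t
  rw [hK] at this
  have h₂ := (map_eq_zero_iff _ A.symm.injective).1 this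
  rw [sub_eq_zero] at h₂
  simpa [hA] using h₂

/-- The determinant of two plane vectors. -/
def planeCross (d : ℝ × ℝ) : ℝ × ℝ →L[ℝ] ℝ :=
  d.1 • ContinuousLinearMap.snd ℝ ℝ ℝ - d.2 • ContinuousLinearMap.fst ℝ ℝ ℝ

theorem planeCross_apply (d e : ℝ × ℝ) : planeCross d e = d.1 * e.2 - d.2 * e.1 := by
  simp [planeCross]

theorem planeCross_smul_eq (d e w : ℝ × ℝ) :
    planeCross d e • w = planeCross w e • d + planeCross d w • e := by
  ext <;> simp [planeCross_apply] <;> ring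

theorem planeCross_eq_zero_of_lines {H : ℝ × ℝ → ℝ × ℝ} {p q d e : ℝ × ℝ} (hpq : H p ≠ H q)
    (hd : ∀ t : ℝ, H (p + t • d) = H p) (he : ∀ t : ℝ, H (q + t • e) = H q) :
    planeCross d e = 0 := by
  by_contra h
  apply hpq
  have hc := congrArg (fun v => (planeCross d e)⁻¹ • v) (planeCross_smul_eq d e (q - p))
  simp only [smul_add, smul_smul, inv_mul_cancel₀ h, one_smul] at hc
  rw [← hd ((planeCross d e)⁻¹ * planeCross (q - p) e),
    ← he (-((planeCross d e)⁻¹ * planeCross d (q - p)))]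
  congr 1
  rw [neg_smul, ← sub_eq_add_neg, eq_sub_iff_add_eq, add_assoc, ← hc]
  abel

theorem exists_smul_eq_of_planeCross_eq_zero {d e : ℝ × ℝ} (he : e ≠ 0) (h : planeCross d e = 0) :
    ∃ c : ℝ, d = c • e := by
  rw [planeCross_apply] at h
  by_cases h₁ : e.1 = 0
  · have h₂ : e.2 ≠ 0 := fun h₂ => he (Prod.ext h₁ h₂)
    refine ⟨d.2 / e.2, Prod.ext ?_ ?_⟩
    · have : d.1 * e.2 = 0 := by simpa [h₁] using h
      simpa [h₁, h₂] using this
    · simp [h₂]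
  · refine ⟨d.1 / e.1, Prod.ext ?_ ?_⟩
    · simp [h₁]
    · simp only [Prod.smul_snd, smul_eq_mul]
      field_simp
      linarith

/-- The derivatives of a planar `C¹` map with square-zero derivative have a common kernel vector. -/
theorem exists_common_kernel {H : ℝ × ℝ → ℝ × ℝ} (hH : ContDiff ℝ 1 H)
    (hN : ∀ z w, fderiv ℝ H z (fderiv ℝ H z w) = 0) :
    ∃ d : ℝ × ℝ, d ≠ 0 ∧ ∀ z, fderiv ℝ H z d = 0 := by
  by_cases hne : ∃ p, fderiv ℝ H p ≠ 0
  swap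
  · push Not at hne
    exact ⟨(1, 0), by simp, fun z => by simp [hne z]⟩
  obtain ⟨p, hp⟩ := hne
  obtain ⟨q, hq, hpq⟩ : ∃ q, fderiv ℝ H q ≠ 0 ∧ H p ≠ H q := by
    by_contra! h
    have hev : ∀ᶠ q in 𝓝 p, fderiv ℝ H q ≠ 0 :=
      (hH.continuous_fderiv one_ne_zero).continuousAt.eventually_ne hp
    have heq : H =ᶠ[𝓝 p] fun _ => H p := hev.mono fun q hq => (h q hq).symm
    exact hp (by rw [heq.fderiv_eq, fderiv_const_apply])
  obtain ⟨d, hd, hdl⟩ := exists_line hH hN hp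
  obtain ⟨d', hd', hdl'⟩ := exists_line hH hN hq
  refine ⟨d, hd, fun r => ?_⟩
  by_cases hr : fderiv ℝ H r = 0
  · simp [hr]
  obtain ⟨e, he, hel⟩ := exists_line hH hN hr
  have hde : planeCross d e = 0 := by
    by_cases hpr : H p = H r
    · have h₁ := planeCross_eq_zero_of_lines hpq hdl hdl'
      have h₂ := planeCross_eq_zero_of_lines (hpr ▸ hpq.symm) hdl' hel
      obtain ⟨c, rfl⟩ := exists_smul_eq_of_planeCross_eq_zero hd' h₁
      rw [planeCross_apply] at h₂ ⊢
      simp only [Prod.smul_fst, Prod.smul_snd, smul_eq_mul]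
      linear_combination c * h₂
    · exact planeCross_eq_zero_of_lines hpr hdl hel
  obtain ⟨c, rfl⟩ := exists_smul_eq_of_planeCross_eq_zero he hde
  have h₁ : HasDerivAt (fun t : ℝ => H (r + t • e)) (fderiv ℝ H r e) 0 := by
    have hl : HasDerivAt (fun t : ℝ => r + t • e) e 0 := by
      simpa using ((hasDerivAt_id (0 : ℝ)).smul_const e).const_add r
    refine HasFDerivAt.comp_hasDerivAt_of_eq (0 : ℝ)
      (hH.differentiable one_ne_zero r).hasFDerivAt hl (by simp)
  rw [funext hel] at h₁
  rw [map_smul, h₁.unique (hasDerivAt_const _ _), smul_zero]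

/-- A planar `C¹` map `H` with square-zero derivative factors through a linear form `planeCross d`,
whose value along `H` is constant. -/
theorem exists_direction {H : ℝ × ℝ → ℝ × ℝ} (hH : ContDiff ℝ 1 H)
    (hN : ∀ z w, fderiv ℝ H z (fderiv ℝ H z w) = 0) :
    ∃ d : ℝ × ℝ, d ≠ 0 ∧ (∀ z (t : ℝ), H (z + t • d) = H z) ∧
      ∀ z, planeCross d (H z) = planeCross d (H 0) := by
  obtain ⟨d, hd, hk⟩ := exists_common_kernel hH hN
  have hdiff := hH.differentiable one_ne_zero
  refine ⟨d, hd, fun z t => ?_, fun z => ?_⟩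
  · have hder : ∀ t : ℝ, HasDerivAt (fun t : ℝ => H (z + t • d)) 0 t := by
      intro t
      have hl : HasDerivAt (fun t : ℝ => z + t • d) d t := by
        simpa using ((hasDerivAt_id t).smul_const d).const_add z
      have h := (hdiff (z + t • d)).hasFDerivAt.comp_hasDerivAt t hl
      rwa [hk] at h
    simpa using is_const_of_deriv_eq_zero (fun t => (hder t).differentiableAt)
      (fun t => (hder t).deriv) t 0
  · have hder : ∀ z, HasFDerivAt (fun z => planeCross d (H z)) (0 : ℝ × ℝ →L[ℝ] ℝ) z := by
      intro z
      refine ((planeCross d).hasFDerivAt.comp z (hdiff z).hasFDerivAt).congr_fderiv ?_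
      refine ContinuousLinearMap.ext fun w => ?_
      by_contra hne
      have hc := congrArg (fderiv ℝ H z) (planeCross_smul_eq d (fderiv ℝ H z w) w)
      rw [map_add, map_smul, map_smul, map_smul, hk, hN, smul_zero, smul_zero, add_zero] at hc
      rcases smul_eq_zero.1 hc with h | h
      · exact hne h
      · exact hne (by simp [h])
    exact is_const_of_fderiv_eq_zero (fun z => (hder z).differentiableAt)
      (fun z => (hder z).fderiv) z 0

theorem Unipotent.sq_fderiv_sub_id {G : ℝ × ℝ → ℝ × ℝ} (hU : Unipotent G) (z w : ℝ × ℝ) :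
    (fderiv ℝ G z - .id ℝ (ℝ × ℝ)) ((fderiv ℝ G z - .id ℝ (ℝ × ℝ)) w) = 0 := by
  obtain ⟨ht, hdet⟩ := hU z
  have hw : ∀ w, (fderiv ℝ G z - .id ℝ (ℝ × ℝ)) w =
      w.1 • fderiv ℝ G z (1, 0) + w.2 • fderiv ℝ G z (0, 1) - w := fun w => by
    rw [← apply_eq_smul_add_smul]
    rfl
  generalize fderiv ℝ G z (1, 0) = f₁ at *
  generalize fderiv ℝ G z (0, 1) = f₂ at *
  obtain ⟨a, c⟩ := f₁
  obtain ⟨b, d⟩ := f₂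
  obtain ⟨x, y⟩ := w
  obtain rfl : d = 2 - a := by simp only at ht; linarith
  simp only [hw]
  ext
  · simp only [Prod.fst_sub, Prod.fst_add, Prod.smul_fst, Prod.snd_sub, Prod.snd_add,
      Prod.smul_snd, smul_eq_mul, Prod.fst_zero] at hdet ⊢
    linear_combination -x * hdet
  · simp only [Prod.fst_sub, Prod.fst_add, Prod.smul_fst, Prod.snd_sub, Prod.snd_add,
      Prod.smul_snd, smul_eq_mul, Prod.snd_zero] at hdet ⊢
    linear_combination -y * hdet

/-- for a nonlinear `C¹` unipotent map fixing the origin and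
`0 < μ < 1`, the perturbed map `G_μ z = G z - μ • z` has the origin as a global
attractor. -/
theorem statement15 (G : ℝ × ℝ → ℝ × ℝ) (hG : ContDiff ℝ 1 G) (hU : Unipotent G)
    (hNL : NonlinearMap G) (h0 : G (0, 0) = (0, 0))
    (μ : ℝ) (hμ : 0 < μ) (hμ1 : μ < 1)
    (Gμ : ℝ × ℝ → ℝ × ℝ) (hGμ : ∀ z : ℝ × ℝ, Gμ z = G z - μ • z) :
    Gμ (0, 0) = (0, 0) ∧
      ∀ z : ℝ × ℝ, Tendsto (fun n : ℕ => Gμ^[n] z) atTop (𝓝 (0, 0)) := by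
  refine ⟨by rw [hGμ, h0, Prod.mk_zero_zero, smul_zero, sub_zero], fun z => ?_⟩
  set H : ℝ × ℝ → ℝ × ℝ := fun z => G z - z with hH
  have hHC : ContDiff ℝ 1 H := hG.sub contDiff_id
  have hHd : ∀ z, fderiv ℝ H z = fderiv ℝ G z - .id ℝ (ℝ × ℝ) := fun z =>
    ((hG.differentiable one_ne_zero z).hasFDerivAt.sub (hasFDerivAt_id z)).fderiv
  obtain ⟨d, hd, hinv, hcr⟩ := exists_direction hHC fun z w => by
    rw [hHd]
    exact hU.sq_fderiv_sub_id z w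
  have hH0 : H 0 = 0 := by
    rw [Prod.mk_zero_zero] at h0
    simp [hH, h0]
  have hGH : ∀ z, Gμ z = (1 - μ) • z + H z := fun z => by
    simp only [hGμ, hH, sub_smul, one_smul]
    abel
  have hω : ∀ n, planeCross d (Gμ^[n] z) = (1 - μ) ^ n * planeCross d z := by
    intro n
    induction n with
    | zero => simp
    | succ n ih =>
      rw [Function.iterate_succ_apply', hGH, map_add, map_smul, ih, hcr, hH0, map_zero, smul_eq_mul]
      ring
  obtain ⟨e, hde⟩ : ∃ e, planeCross d e = 1 := by
    have hne : d.1 ^ 2 + d.2 ^ 2 ≠ 0 := by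
      intro h
      have h₁ : d.1 = 0 := by nlinarith [sq_nonneg d.1, sq_nonneg d.2]
      have h₂ : d.2 = 0 := by nlinarith [sq_nonneg d.1, sq_nonneg d.2]
      exact hd (Prod.ext h₁ h₂)
    refine ⟨(-d.2 / (d.1 ^ 2 + d.2 ^ 2), d.1 / (d.1 ^ 2 + d.2 ^ 2)), ?_⟩
    rw [planeCross_apply]
    field_simp
    ring
  have hfac : ∀ w, H w = H (planeCross d w • e) := fun w => by
    rw [← hinv (planeCross d w • e) (planeCross w e), add_comm, ← planeCross_smul_eq, hde, one_smul]
  have hlim : Tendsto (fun n => H (Gμ^[n] z)) atTop (𝓝 0) := by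
    have hpow : Tendsto (fun n : ℕ => ((1 - μ) ^ n * planeCross d z) • e) atTop (𝓝 0) := by
      simpa using ((tendsto_pow_atTop_nhds_zero_of_lt_one (by linarith)
        (by linarith : 1 - μ < 1)).mul_const (planeCross d z)).smul_const e
    have hHt : Tendsto H (𝓝 0) (𝓝 0) := by
      simpa only [hH0] using hHC.continuous.tendsto 0
    refine (hHt.comp hpow).congr fun n => ?_
    rw [Function.comp_apply, ← hω, ← hfac]
  rw [Prod.mk_zero_zero]
  exact tendsto_zero_of_contracting (z := fun n => Gμ^[n] z) (c := 1 - μ) (by linarith)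
    (by linarith) hlim fun n => by
    rw [Function.iterate_succ_apply', hGH]
end

section
/- Let G : ℝ² → ℝ² be a continuously differentiable map which is unipotent, nonlinear, and satisfies G(0,0) = (0,0). For μ ∈ ℝ define G_μ : ℝ² → ℝ² by G_μ(z) = G(z) − μ·z. Then for every μ with −1 < μ < 1, the map G_μ has no periodic points: for every z ∈ ℝ² and every integer n ≥ 1, if G_μ^n(z) = z then G_μ(z) = z. -/
open Filter Topology

/-- Level sets of a `C¹` function are locally graphs, `C¹` in the level. -/
lemma exists_levelGraph {f : ℝ × ℝ → ℝ} (hf : ContDiff ℝ 1 f) {x₀ y₀ : ℝ}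
    (h : fderiv ℝ f (x₀, y₀) (0, 1) ≠ 0) :
    ∃ Y : ℝ × ℝ → ℝ, Y (x₀, f (x₀, y₀)) = y₀ ∧
      ∃ δ > 0, ∀ x ∈ Metric.ball x₀ δ, ∀ p ∈ Metric.ball (f (x₀, y₀)) δ,
        DifferentiableAt ℝ Y (x, p) ∧ f (x, Y (x, p)) = p := by
  set p₀ := f (x₀, y₀) with hp₀
  let k : (ℝ × ℝ) × ℝ → ℝ := fun w => f (w.1.1, w.2) - w.1.2
  have hk : ContDiff ℝ 1 k := by
    simp only [k]; fun_prop
  have hdk : (fderiv ℝ k ((x₀, p₀), y₀) ∘L .inr ℝ (ℝ × ℝ) ℝ) 1 = fderiv ℝ f (x₀, y₀) (0, 1) := by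
    have h1 : HasFDerivAt k _ ((x₀, p₀), y₀) :=
      ((hf.differentiable one_ne_zero (x₀, y₀)).hasFDerivAt.comp
        (f := fun w : (ℝ × ℝ) × ℝ => (w.1.1, w.2)) ((x₀, p₀), y₀)
        ((hasFDerivAt_fst.comp ((x₀, p₀), y₀) hasFDerivAt_fst).prodMk hasFDerivAt_snd)).sub
        (hasFDerivAt_snd.comp ((x₀, p₀), y₀) hasFDerivAt_fst)
    rw [h1.fderiv]
    simp
  have hinv : (fderiv ℝ k ((x₀, p₀), y₀) ∘L .inr ℝ (ℝ × ℝ) ℝ).IsInvertible := by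
    refine ⟨ContinuousLinearEquiv.unitsEquivAut ℝ (Units.mk0 _ h), ?_⟩
    ext
    rw [hdk]
    simp
  have hkat := hk.contDiffAt (x := ((x₀, p₀), y₀))
  refine ⟨hkat.implicitFunction one_ne_zero hinv, ?_, ?_⟩
  · exact hkat.implicitFunction_apply_self one_ne_zero hinv
  · have e1 := (hkat.contDiffAt_implicitFunction one_ne_zero hinv).eventually (by simp)
    have e2 := hkat.eventually_apply_implicitFunction one_ne_zero hinv
    obtain ⟨δ, hδ, H⟩ := Metric.eventually_nhds_iff_ball.1 (e1.and e2)
    refine ⟨δ, hδ, fun x hx p hp => ?_⟩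
    have hxp : (x, p) ∈ Metric.ball (x₀, p₀) δ := by
      rw [← ball_prod_same]; exact ⟨hx, hp⟩
    obtain ⟨h1, h2⟩ := H _ hxp
    refine ⟨h1.differentiableAt one_ne_zero, ?_⟩
    simpa [k, ← hp₀, sub_eq_zero] using h2

lemma hasDerivAt_comp_graph_left {h Y : ℝ × ℝ → ℝ} {x p : ℝ}
    (hh : DifferentiableAt ℝ h (x, Y (x, p))) (hY : DifferentiableAt ℝ Y (x, p)) :
    HasDerivAt (fun t => h (t, Y (t, p)))
      (fderiv ℝ h (x, Y (x, p)) (1, 0) +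
        fderiv ℝ h (x, Y (x, p)) (0, 1) * fderiv ℝ Y (x, p) (1, 0)) x := by
  have h1 : HasDerivAt (fun t : ℝ => (t, p)) (1, 0) x :=
    (hasDerivAt_id x).prodMk (hasDerivAt_const x p)
  have h2 : HasDerivAt (fun t => Y (t, p)) (fderiv ℝ Y (x, p) (1, 0)) x :=
    hY.hasFDerivAt.comp_hasDerivAt x h1
  have h3 := hh.hasFDerivAt.comp_hasDerivAt x ((hasDerivAt_id x).prodMk h2)
  convert! h3 using 1
  rw [show ((1 : ℝ), fderiv ℝ Y (x, p) (1, 0)) =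
    (1, 0) + fderiv ℝ Y (x, p) (1, 0) • ((0 : ℝ), (1 : ℝ)) by simp, map_add, map_smul,
    smul_eq_mul, mul_comm]

lemma hasDerivAt_comp_graph_right {h Y : ℝ × ℝ → ℝ} {x p : ℝ}
    (hh : DifferentiableAt ℝ h (x, Y (x, p))) (hY : DifferentiableAt ℝ Y (x, p)) :
    HasDerivAt (fun q => h (x, Y (x, q)))
      (fderiv ℝ h (x, Y (x, p)) (0, 1) * fderiv ℝ Y (x, p) (0, 1)) p := by
  have h1 : HasDerivAt (fun q : ℝ => (x, q)) (0, 1) p :=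
    (hasDerivAt_const p x).prodMk (hasDerivAt_id p)
  have h2 : HasDerivAt (fun q => Y (x, q)) (fderiv ℝ Y (x, p) (0, 1)) p :=
    hY.hasFDerivAt.comp_hasDerivAt p h1
  have h3 := hh.hasFDerivAt.comp_hasDerivAt p ((hasDerivAt_const p x).prodMk h2)
  convert! h3 using 1
  rw [show ((0 : ℝ), fderiv ℝ Y (x, p) (0, 1)) =
    fderiv ℝ Y (x, p) (0, 1) • ((0 : ℝ), (1 : ℝ)) by simp, map_smul,
    smul_eq_mul, mul_comm]

lemma eq_center_of_hasDerivAt_zero {u : ℝ → ℝ} {x₀ δ : ℝ}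
    (hu : ∀ x ∈ Metric.ball x₀ δ, HasDerivAt u 0 x) {x : ℝ} (hx : x ∈ Metric.ball x₀ δ) :
    u x = u x₀ :=
  Metric.isOpen_ball.is_const_of_deriv_eq_zero (convex_ball x₀ δ).isPreconnected
    (fun t ht => (hu t ht).differentiableAt.differentiableWithinAt)
    (fun t ht => (hu t ht).deriv) hx
    (Metric.mem_ball_self ((dist_nonneg).trans_lt hx))

/-- Near a point where a planar `C¹` map `(f, g)` with nilpotent Jacobian has a nonzero Jacobian
with horizontal kernel, `(f, g)` is constant along the horizontal line, and the reciprocal of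
`∂f/∂y` is affine along it. -/
lemma eventually_const_horizontal {f g : ℝ × ℝ → ℝ} (hf : ContDiff ℝ 1 f) (hg : ContDiff ℝ 1 g)
    (htr : ∀ z, fderiv ℝ f z (1, 0) + fderiv ℝ g z (0, 1) = 0)
    (hdet : ∀ z, fderiv ℝ f z (1, 0) * fderiv ℝ g z (0, 1) =
      fderiv ℝ f z (0, 1) * fderiv ℝ g z (1, 0))
    {x₀ y₀ : ℝ} (hfx : fderiv ℝ f (x₀, y₀) (1, 0) = 0)
    (hfy : fderiv ℝ f (x₀, y₀) (0, 1) ≠ 0) :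
    ∃ a b : ℝ, ∀ᶠ x in 𝓝 x₀, f (x, y₀) = f (x₀, y₀) ∧ g (x, y₀) = g (x₀, y₀) ∧
      fderiv ℝ f (x, y₀) (1, 0) = 0 ∧ fderiv ℝ g (x, y₀) (1, 0) = 0 ∧
      fderiv ℝ f (x, y₀) (0, 1) * (a + b * x) = 1 := by
  obtain ⟨Y, hY₀, δ, hδ, hY⟩ := exists_levelGraph hf hfy
  set p₀ := f (x₀, y₀) with hp₀
  have df := hf.differentiable one_ne_zero
  have dg := hg.differentiable one_ne_zero
  have x₀_mem : x₀ ∈ Metric.ball x₀ δ := Metric.mem_ball_self hδ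
  have p₀_mem : p₀ ∈ Metric.ball p₀ δ := Metric.mem_ball_self hδ
  have near_x : ∀ {x}, x ∈ Metric.ball x₀ δ → ∀ᶠ t in 𝓝 x, t ∈ Metric.ball x₀ δ :=
    fun hx => Metric.isOpen_ball.mem_nhds hx
  have near_p : ∀ {p}, p ∈ Metric.ball p₀ δ → ∀ᶠ t in 𝓝 p, t ∈ Metric.ball p₀ δ :=
    fun hp => Metric.isOpen_ball.mem_nhds hp
  have hfX : ∀ x ∈ Metric.ball x₀ δ, ∀ p ∈ Metric.ball p₀ δ,
      fderiv ℝ f (x, Y (x, p)) (1, 0) +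
        fderiv ℝ f (x, Y (x, p)) (0, 1) * fderiv ℝ Y (x, p) (1, 0) = 0 := by
    intro x hx p hp
    refine (hasDerivAt_comp_graph_left (df _) (hY x hx p hp).1).unique
      ((hasDerivAt_const x p).congr_of_eventuallyEq ?_)
    filter_upwards [near_x hx] with t ht using (hY t ht p hp).2
  have hfP : ∀ x ∈ Metric.ball x₀ δ, ∀ p ∈ Metric.ball p₀ δ,
      fderiv ℝ f (x, Y (x, p)) (0, 1) * fderiv ℝ Y (x, p) (0, 1) = 1 := by
    intro x hx p hp
    refine (hasDerivAt_comp_graph_right (df _) (hY x hx p hp).1).unique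
      ((hasDerivAt_id p).congr_of_eventuallyEq ?_)
    filter_upwards [near_p hp] with t ht using (hY x hx t ht).2
  have hgX : ∀ x ∈ Metric.ball x₀ δ, ∀ p ∈ Metric.ball p₀ δ,
      fderiv ℝ g (x, Y (x, p)) (1, 0) +
        fderiv ℝ g (x, Y (x, p)) (0, 1) * fderiv ℝ Y (x, p) (1, 0) = 0 := by
    intro x hx p hp
    have h1 := hfX x hx p hp
    have h2 := hfP x hx p hp
    refine (mul_eq_zero_iff_left (left_ne_zero_of_mul_eq_one h2)).1 ?_
    linear_combination (fderiv ℝ g (x, Y (x, p)) (0, 1)) * h1 - hdet (x, Y (x, p))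
  have hgc : ∀ x ∈ Metric.ball x₀ δ, ∀ p ∈ Metric.ball p₀ δ,
      g (x, Y (x, p)) = g (x₀, Y (x₀, p)) := by
    intro x hx p hp
    refine eq_center_of_hasDerivAt_zero (u := fun t => g (t, Y (t, p))) (fun t ht => ?_) hx
    rw [← hgX t ht p hp]
    exact hasDerivAt_comp_graph_left (dg _) (hY t ht p hp).1
  set m : ℝ → ℝ := deriv fun p => g (x₀, Y (x₀, p))
  have hgP : ∀ x ∈ Metric.ball x₀ δ, ∀ p ∈ Metric.ball p₀ δ,
      fderiv ℝ g (x, Y (x, p)) (0, 1) * fderiv ℝ Y (x, p) (0, 1) = m p := by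
    intro x hx p hp
    refine (((hasDerivAt_comp_graph_right (dg _) (hY x hx p hp).1).congr_of_eventuallyEq
      ?_).deriv).symm
    filter_upwards [near_p hp] with t ht using (hgc x hx t ht).symm
  have hYX : ∀ x ∈ Metric.ball x₀ δ, ∀ p ∈ Metric.ball p₀ δ,
      fderiv ℝ Y (x, p) (1, 0) = m p := by
    intro x hx p hp
    linear_combination hgP x hx p hp + fderiv ℝ Y (x, p) (0, 1) * hfX x hx p hp
      - fderiv ℝ Y (x, p) (1, 0) * hfP x hx p hp
      - fderiv ℝ Y (x, p) (0, 1) * htr (x, Y (x, p))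
  have hYaff : ∀ x ∈ Metric.ball x₀ δ, ∀ p ∈ Metric.ball p₀ δ,
      Y (x, p) = Y (x₀, p) + (x - x₀) * m p := by
    intro x hx p hp
    have h1 := eq_center_of_hasDerivAt_zero (u := fun t => Y (t, p) - (t - x₀) * m p)
      (fun t ht => ?_) hx
    · simp only [sub_self, zero_mul] at h1
      linarith
    · have h2 := hasDerivAt_comp_graph_left (h := Prod.snd) differentiableAt_snd (hY t ht p hp).1
      convert! h2.sub (((hasDerivAt_id t).sub_const x₀).mul_const (m p)) using 1
      simp [fderiv_snd, hYX t ht p hp]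
  have hYP : ∀ x ∈ Metric.ball x₀ δ,
      HasDerivAt (fun p => Y (x, p)) (fderiv ℝ Y (x, p₀) (0, 1)) p₀ := by
    intro x hx
    simpa [fderiv_snd] using
      hasDerivAt_comp_graph_right (h := Prod.snd) differentiableAt_snd (hY x hx p₀ p₀_mem).1
  have hm₀ : m p₀ = 0 := by
    have h1 := htr (x₀, y₀)
    rw [hfx, zero_add] at h1
    rw [← hgP x₀ x₀_mem p₀ p₀_mem, hY₀, h1, zero_mul]
  have hYc : ∀ x ∈ Metric.ball x₀ δ, Y (x, p₀) = y₀ := by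
    intro x hx
    rw [hYaff x hx p₀ p₀_mem, hm₀, hY₀, mul_zero, add_zero]
  obtain ⟨K, hK⟩ : ∃ K, HasDerivAt m K p₀ := by
    have hx₁ : x₀ + δ / 2 ∈ Metric.ball x₀ δ := by
      simp [abs_of_pos hδ, hδ]
    refine ⟨_, (((hYP _ hx₁).sub (hYP x₀ x₀_mem)).div_const (δ / 2)).congr_of_eventuallyEq ?_⟩
    filter_upwards [near_p p₀_mem] with p hp
    rw [Pi.sub_apply, hYaff _ hx₁ p hp]
    field_simp
    ring
  refine ⟨fderiv ℝ Y (x₀, p₀) (0, 1) - x₀ * K, K, ?_⟩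
  filter_upwards [near_x x₀_mem] with x hx
  have hYPx : fderiv ℝ Y (x, p₀) (0, 1) = fderiv ℝ Y (x₀, p₀) (0, 1) + (x - x₀) * K := by
    refine (hYP x hx).unique (((hYP x₀ x₀_mem).add (hK.const_mul (x - x₀))).congr_of_eventuallyEq ?_)
    filter_upwards [near_p p₀_mem] with p hp using hYaff x hx p hp
  have e1 := (hY x hx p₀ p₀_mem).2
  have e2 := hgc x hx p₀ p₀_mem
  have e3 := hfX x hx p₀ p₀_mem
  have e4 := hgX x hx p₀ p₀_mem
  have e5 := hfP x hx p₀ p₀_mem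
  rw [hYX x hx p₀ p₀_mem, hm₀, mul_zero, add_zero] at e3 e4
  rw [hYc x hx] at e1 e2 e3 e4 e5
  rw [hYc x₀ x₀_mem] at e2
  refine ⟨e1, e2, e3, e4, ?_⟩
  rw [hYPx] at e5
  linear_combination e5

/-- A planar `C¹` map `(f, g)` with nilpotent Jacobian is constant along the whole horizontal line
through a point where the Jacobian is nonzero with horizontal kernel. -/
lemma const_horizontal {f g : ℝ × ℝ → ℝ} (hf : ContDiff ℝ 1 f) (hg : ContDiff ℝ 1 g)
    (htr : ∀ z, fderiv ℝ f z (1, 0) + fderiv ℝ g z (0, 1) = 0)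
    (hdet : ∀ z, fderiv ℝ f z (1, 0) * fderiv ℝ g z (0, 1) =
      fderiv ℝ f z (0, 1) * fderiv ℝ g z (1, 0))
    {x₀ y₀ : ℝ} (hfx : fderiv ℝ f (x₀, y₀) (1, 0) = 0)
    (hfy : fderiv ℝ f (x₀, y₀) (0, 1) ≠ 0) (x : ℝ) :
    f (x, y₀) = f (x₀, y₀) ∧ g (x, y₀) = g (x₀, y₀) := by
  obtain ⟨a, b, hab⟩ := eventually_const_horizontal hf hg htr hdet hfx hfy
  have cf := hf.continuous
  have cg := hg.continuous
  have cf' := hf.continuous_fderiv one_ne_zero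
  set S : Set ℝ := {x | f (x, y₀) = f (x₀, y₀) ∧ g (x, y₀) = g (x₀, y₀) ∧
      fderiv ℝ f (x, y₀) (1, 0) = 0 ∧ fderiv ℝ f (x, y₀) (0, 1) * (a + b * x) = 1} with hS
  have S_closed : IsClosed S := by
    refine (isClosed_eq ?_ ?_).inter ((isClosed_eq ?_ ?_).inter ((isClosed_eq ?_ ?_).inter
      (isClosed_eq ?_ ?_))) <;> fun_prop
  have hclopen : IsClopen (interior S) := by
    refine ⟨isClosed_of_closure_subset fun s hs => ?_, isOpen_interior⟩
    obtain ⟨h1, h2, h3, h4⟩ : s ∈ S := closure_minimal interior_subset S_closed hs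
    obtain ⟨a', b', hab'⟩ :=
      eventually_const_horizontal hf hg htr hdet h3 (left_ne_zero_of_mul_eq_one h4)
    obtain ⟨U, hU, U_open, hsU⟩ := eventually_nhds_iff.1 hab'
    have hV : IsOpen (U ∩ interior S) := U_open.inter isOpen_interior
    obtain ⟨t, ht⟩ := mem_closure_iff.1 hs U U_open hsU
    have hagree : ∀ r ∈ U ∩ interior S, a' + b' * r = a + b * r := by
      rintro r ⟨hrU, hrS⟩
      have e1 := (hU r hrU).2.2.2.2
      have e2 := (interior_subset hrS).2.2.2
      exact mul_left_cancel₀ (left_ne_zero_of_mul_eq_one e1) (e1.trans e2.symm)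
    obtain ⟨ε, hε, hball⟩ := Metric.isOpen_iff.1 hV t ht
    have e1 := hagree t ht
    have e2 := hagree (t + ε / 2) (hball (by simp [abs_of_pos hε, hε]))
    have hb : b' = b := by
      have : (b' - b) * (ε / 2) = 0 := by linear_combination e2 - e1
      rcases mul_eq_zero.1 this with h | h <;> linarith
    have ha : a' = a := by rw [hb] at e1; linarith
    rw [mem_interior_iff_mem_nhds]
    filter_upwards [hab'] with r hr
    rw [ha, hb] at hr
    exact ⟨hr.1.trans h1, hr.2.1.trans h2, hr.2.2.1, hr.2.2.2.2⟩
  have hx₀ : x₀ ∈ interior S := by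
    rw [mem_interior_iff_mem_nhds]
    filter_upwards [hab] with r hr using ⟨hr.1, hr.2.1, hr.2.2.1, hr.2.2.2.2⟩
  have hx : x ∈ interior S := by rw [hclopen.eq_univ ⟨x₀, hx₀⟩]; trivial
  exact ⟨(interior_subset hx).1, (interior_subset hx).2.1⟩

lemma ContinuousLinearMap.apply_eq_smul_add_smul (N : ℝ × ℝ →L[ℝ] ℝ × ℝ) (v : ℝ × ℝ) :
    N v = v.1 • N (1, 0) + v.2 • N (0, 1) := by
  rw [← map_smul, ← map_smul, ← map_add]
  simp

/-- A planar endomorphism of square zero has trace and determinant zero. -/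
lemma trace_det_of_sq_zero {N : ℝ × ℝ →L[ℝ] ℝ × ℝ} (hN : ∀ v, N (N v) = 0) :
    (N (1, 0)).1 + (N (0, 1)).2 = 0 ∧
      (N (1, 0)).1 * (N (0, 1)).2 = (N (0, 1)).1 * (N (1, 0)).2 := by
  have h1 := hN (1, 0)
  have h2 := hN (0, 1)
  rw [N.apply_eq_smul_add_smul (N _)] at h1 h2
  simp only [Prod.ext_iff, Prod.fst_add, Prod.snd_add, Prod.smul_fst, Prod.smul_snd, smul_eq_mul,
    Prod.fst_zero, Prod.snd_zero] at h1 h2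
  obtain ⟨h11, h12⟩ := h1
  obtain ⟨h21, h22⟩ := h2
  generalize (N (1, 0)).1 = a at *
  generalize (N (1, 0)).2 = c at *
  generalize (N (0, 1)).1 = b at *
  generalize (N (0, 1)).2 = d at *
  have ht : a + d = 0 := by
    have h3 : (a + d) ^ 3 = 0 := by
      by_cases h : a + d = 0
      · rw [h]; ring
      · have hc : c = 0 := (mul_eq_zero_iff_right h).1 (by linear_combination h12)
        rw [hc] at h11 h22
        have ha : a = 0 := mul_self_eq_zero.1 (by linear_combination h11)
        have hd : d = 0 := mul_self_eq_zero.1 (by linear_combination h22)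
        rw [ha, hd]; ring
    exact pow_eq_zero_iff three_ne_zero |>.1 h3
  exact ⟨ht, by linear_combination a * ht - h11⟩

lemma sq_zero_of_trace_det {N : ℝ × ℝ →L[ℝ] ℝ × ℝ} (ht : (N (1, 0)).1 + (N (0, 1)).2 = 0)
    (hd : (N (1, 0)).1 * (N (0, 1)).2 = (N (0, 1)).1 * (N (1, 0)).2) (v : ℝ × ℝ) :
    N (N v) = 0 := by
  rw [N.apply_eq_smul_add_smul (N v), N.apply_eq_smul_add_smul v]
  ext
  · simp only [Prod.fst_add, Prod.snd_add, Prod.smul_fst, Prod.smul_snd, smul_eq_mul, Prod.fst_zero]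
    linear_combination (v.1 * (N (1, 0)).1 + v.2 * (N (0, 1)).1) * ht - v.1 * hd
  · simp only [Prod.fst_add, Prod.snd_add, Prod.smul_fst, Prod.smul_snd, smul_eq_mul, Prod.snd_zero]
    linear_combination (v.1 * (N (1, 0)).2 + v.2 * (N (0, 1)).2) * ht - v.2 * hd

/-- A planar `C¹` map with nilpotent derivative is constant along the line through any point in
any direction of the range of the derivative there. -/
lemma const_along_range {F : ℝ × ℝ → ℝ × ℝ} (hF : ContDiff ℝ 1 F)
    (hN : ∀ z v, fderiv ℝ F z (fderiv ℝ F z v) = 0) (z v : ℝ × ℝ) (s : ℝ) :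
    F (z + s • fderiv ℝ F z v) = F z := by
  set e := fderiv ℝ F z v with he
  by_cases he₀ : e = 0
  · simp [he₀]
  let P : ℝ × ℝ →ₗ[ℝ] ℝ × ℝ :=
    (LinearMap.fst ℝ ℝ ℝ).smulRight e + (LinearMap.snd ℝ ℝ ℝ).smulRight v
  have hP : Function.Injective P := by
    rw [injective_iff_map_eq_zero]
    rintro ⟨s, t⟩ h
    have h' : s • e + t • v = 0 := h
    have ht := congrArg (fderiv ℝ F z) h'
    rw [map_add, map_smul, map_smul, hN, smul_zero, zero_add, map_zero, ← he,
      smul_eq_zero_iff_left he₀] at ht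
    rw [ht, zero_smul, add_zero, smul_eq_zero_iff_left he₀] at h'
    rw [h', ht]; rfl
  let A : (ℝ × ℝ) ≃L[ℝ] ℝ × ℝ := (LinearEquiv.ofInjectiveEndo P hP).toContinuousLinearEquiv
  have hA : ∀ w, A w = w.1 • e + w.2 • v := fun w => rfl
  let H : ℝ × ℝ → ℝ × ℝ := fun w => A.symm (F (z + A w))
  have hH : ContDiff ℝ 1 H := by
    simp only [H]; fun_prop
  have hH' : ∀ w u, fderiv ℝ H w u = A.symm (fderiv ℝ F (z + A w) (A u)) := by
    intro w u
    have h1 : HasFDerivAt (fun w => z + A w) (A : (ℝ × ℝ) →L[ℝ] ℝ × ℝ) w :=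
      A.hasFDerivAt.const_add z
    have h2 : HasFDerivAt H _ w := A.symm.hasFDerivAt.comp w
      (((hF.differentiable one_ne_zero (z + A w)).hasFDerivAt).comp w h1)
    rw [h2.fderiv]; rfl
  have hHN : ∀ w u, fderiv ℝ H w (fderiv ℝ H w u) = 0 := by
    intro w u
    rw [hH', hH', A.apply_symm_apply, hN, map_zero]
  have hfst : ∀ w u, fderiv ℝ (fun w => (H w).1) w u = (fderiv ℝ H w u).1 := by
    intro w u
    rw [(hH.differentiable one_ne_zero w).hasFDerivAt.fst.fderiv]; rfl
  have hsnd : ∀ w u, fderiv ℝ (fun w => (H w).2) w u = (fderiv ℝ H w u).2 := by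
    intro w u
    rw [(hH.differentiable one_ne_zero w).hasFDerivAt.snd.fderiv]; rfl
  have hA0 : A ((0 : ℝ), (0 : ℝ)) = 0 := map_zero A
  have hA1 : A (1, 0) = e := by simp [hA]
  have hA2 : A (0, 1) = v := by simp [hA]
  have h := const_horizontal (f := fun w => (H w).1) (g := fun w => (H w).2) hH.fst hH.snd
    (fun w => by rw [hfst, hsnd]; exact (trace_det_of_sq_zero (hHN w)).1)
    (fun w => by rw [hfst, hsnd, hfst, hsnd]; exact (trace_det_of_sq_zero (hHN w)).2)
    (x₀ := 0) (y₀ := 0)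
    (by rw [hfst, hH', hA0, add_zero, hA1, hN, map_zero]; rfl)
    (by rw [hfst, hH', hA0, add_zero, hA2, ← he, ← hA1, A.symm_apply_apply]; simp) s
  have h' : H (s, 0) = H (0, 0) := Prod.ext h.1 h.2
  have h'' := A.symm.injective h'
  simpa [hA] using h''

/-- Nonparallel lines in the plane meet. -/
lemma exists_line_inter {e d : ℝ × ℝ} (h : e.1 * d.2 - e.2 * d.1 ≠ 0) (z w : ℝ × ℝ) :
    ∃ s t : ℝ, z + s • e = w + t • d := by
  obtain ⟨D, hD⟩ : ∃ D, (e.1 * d.2 - e.2 * d.1) * D = 1 := ⟨_, mul_inv_cancel₀ h⟩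
  refine ⟨((w.1 - z.1) * d.2 - (w.2 - z.2) * d.1) * D,
    ((w.1 - z.1) * e.2 - (w.2 - z.2) * e.1) * D, ?_⟩
  ext
  · simp only [Prod.fst_add, Prod.smul_fst, smul_eq_mul]
    linear_combination (w.1 - z.1) * hD
  · simp only [Prod.snd_add, Prod.smul_snd, smul_eq_mul]
    linear_combination (w.2 - z.2) * hD

lemma exists_eq_smul_of_cross_eq_zero {e d : ℝ × ℝ} (he : e ≠ 0)
    (h : e.1 * d.2 - e.2 * d.1 = 0) : ∃ c : ℝ, d = c • e := by
  have hn : e.1 ^ 2 + e.2 ^ 2 ≠ 0 := by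
    intro h0
    refine he (Prod.ext ?_ ?_) <;> simp only [Prod.fst_zero, Prod.snd_zero] <;> nlinarith
  refine ⟨(e.1 * d.1 + e.2 * d.2) / (e.1 ^ 2 + e.2 ^ 2), Prod.ext ?_ ?_⟩
  · simp only [Prod.smul_fst, smul_eq_mul]
    field_simp
    linear_combination (-e.2) * h
  · simp only [Prod.smul_snd, smul_eq_mul]
    field_simp
    linear_combination e.1 * h

/-- Structure of planar `C¹` maps with nilpotent, not identically zero derivative: they are
constant along a fixed direction `e` and, up to a constant, take values in the line spanned
by `e`. -/
lemma exists_direction_s17 {F : ℝ × ℝ → ℝ × ℝ} (hF : ContDiff ℝ 1 F)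
    (hN : ∀ z v, fderiv ℝ F z (fderiv ℝ F z v) = 0) (hF' : ∃ z, fderiv ℝ F z ≠ 0) :
    ∃ e : ℝ × ℝ, e ≠ 0 ∧ (∀ z (s : ℝ), F (z + s • e) = F z) ∧
      ∀ z w, e.1 * (F z).2 - e.2 * (F z).1 = e.1 * (F w).2 - e.2 * (F w).1 := by
  obtain ⟨z₀, hz₀⟩ := hF'
  obtain ⟨v₀, hv₀⟩ : ∃ v, fderiv ℝ F z₀ v ≠ 0 := by
    by_contra! h
    exact hz₀ (ContinuousLinearMap.ext h)
  set e := fderiv ℝ F z₀ v₀ with he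
  have dF := hF.differentiable one_ne_zero
  have cF' := hF.continuous_fderiv one_ne_zero
  have cross : ∀ w v, e.1 * (fderiv ℝ F w v).2 - e.2 * (fderiv ℝ F w v).1 = 0 := by
    intro w v
    have hclosed : IsClosed {w | e.1 * (fderiv ℝ F w v).2 - e.2 * (fderiv ℝ F w v).1 = 0} :=
      isClosed_eq (by fun_prop) continuous_const
    by_cases hw : w ∈ closure {w | F w ≠ F z₀}
    · refine closure_minimal (fun y hy => ?_) hclosed hw
      by_contra hne
      obtain ⟨s, t, hst⟩ := exists_line_inter hne z₀ y
      refine hy ?_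
      rw [← const_along_range hF hN y v t, ← hst, const_along_range hF hN]
    · have h1 : F =ᶠ[𝓝 w] fun _ => F z₀ := by
        filter_upwards [isClosed_closure.isOpen_compl.mem_nhds hw] with y hy
        by_contra hne
        exact hy (subset_closure hne)
      rw [h1.fderiv_eq]
      simp
  have ker : ∀ w, fderiv ℝ F w e = 0 := by
    intro w
    by_contra hne
    obtain ⟨c, hc⟩ := exists_eq_smul_of_cross_eq_zero hv₀ (cross w e)
    have h1 := hN w e
    rw [hc, map_smul, smul_eq_zero] at h1
    rcases h1 with h1 | h1
    · rw [h1, zero_smul] at hc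
      exact hne hc
    · exact hne h1
  refine ⟨e, hv₀, fun z s => ?_, ?_⟩
  · have hline : ∀ t : ℝ, HasDerivAt (fun t : ℝ => F (z + t • e)) 0 t := by
      intro t
      have h1 : HasDerivAt (fun t : ℝ => z + t • e) ((1 : ℝ) • e) t :=
        ((hasDerivAt_id t).smul_const e).const_add z
      have h2 := (dF (z + t • e)).hasFDerivAt.comp_hasDerivAt t h1
      rwa [one_smul, ker] at h2
    simpa using is_const_of_deriv_eq_zero (fun t => (hline t).differentiableAt)
      (fun t => (hline t).deriv) s 0
  · have hd : ∀ z, HasFDerivAt (fun z => e.1 * (F z).2 - e.2 * (F z).1)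
        (0 : ℝ × ℝ →L[ℝ] ℝ) z := by
      intro z
      have h1 := ((dF z).hasFDerivAt.snd.const_mul e.1).sub
        ((dF z).hasFDerivAt.fst.const_mul e.2)
      convert! h1 using 1
      ext <;> simpa using (cross z _).symm
    exact is_const_of_fderiv_eq_zero (fun z => (hd z).differentiableAt) (fun z => (hd z).fderiv)

/-- for a nonlinear `C¹` unipotent map fixing the origin and
`-1 < μ < 1`, the perturbed map `G_μ z = G z - μ • z` has no periodic points. -/
theorem statement17 (G : ℝ × ℝ → ℝ × ℝ) (hG : ContDiff ℝ 1 G) (hU : Unipotent G)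
    (hNL : NonlinearMap G) (h0 : G (0, 0) = (0, 0))
    (μ : ℝ) (hμ : -1 < μ) (hμ1 : μ < 1)
    (Gμ : ℝ × ℝ → ℝ × ℝ) (hGμ : ∀ z : ℝ × ℝ, Gμ z = G z - μ • z) :
    ∀ z : ℝ × ℝ, ∀ n : ℕ, 1 ≤ n → Gμ^[n] z = z → Gμ z = z := by
  obtain ⟨F, hF⟩ : ∃ F : ℝ × ℝ → ℝ × ℝ, F = G - id := ⟨_, rfl⟩
  have hG' : ∀ z v, fderiv ℝ F z v = fderiv ℝ G z v - v := by
    intro z v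
    rw [hF, ((hG.differentiable one_ne_zero z).hasFDerivAt.sub (hasFDerivAt_id z)).fderiv]
    simp
  obtain ⟨e, he, hconst, hcross⟩ := exists_direction_s17 (F := F) (hF ▸ hG.sub contDiff_id)
    (fun z v => by
      obtain ⟨ht, hd⟩ := hU z
      apply sq_zero_of_trace_det <;>
        simp only [hG', Prod.fst_sub, Prod.snd_sub] <;> linarith)
    (by
      by_contra! h
      refine hNL ⟨.id ℝ _, fun z => ContinuousLinearMap.ext fun v => ?_⟩
      have h1 := hG' z v
      rw [h z] at h1
      exact sub_eq_zero.1 h1.symm)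
  have hF0 : F 0 = 0 := by
    have h0' : G 0 = 0 := h0
    simp [hF, h0']
  have hFe : ∀ z, e.1 * (F z).2 - e.2 * (F z).1 = 0 := fun z => by
    rw [hcross z 0, hF0]; simp
  have hGF : ∀ z, Gμ z = (1 - μ) • z + F z := fun z => by
    rw [hGμ, hF, Pi.sub_apply, id_eq]; module
  intro z n hn hz
  have hn0 : n ≠ 0 := by omega
  rcases eq_or_ne μ 0 with rfl | hμ0
  · have hit : ∀ k : ℕ, Gμ^[k] z = z + (k : ℝ) • F z := by
      intro k
      induction k with
      | zero => simp
      | succ k ih =>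
        obtain ⟨c, hc⟩ := exists_eq_smul_of_cross_eq_zero he (hFe z)
        have h1 : F (z + (k : ℝ) • F z) = F z := by
          rw [hc, smul_smul, hconst, hc]
        rw [Function.iterate_succ_apply', ih, hGF, h1]
        push_cast
        module
    rw [hit n, add_eq_left, smul_eq_zero_iff_right (Nat.cast_ne_zero.2 hn0)] at hz
    rw [hGF, hz]
    simp
  · have hpow : (1 - μ) ^ n ≠ 1 := fun h =>
      hμ0 (by linarith [(pow_eq_one_iff_of_nonneg (by linarith : 0 ≤ 1 - μ) hn0).1 h])
    have hu : ∀ k : ℕ, e.1 * (Gμ^[k] z).2 - e.2 * (Gμ^[k] z).1 =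
        (1 - μ) ^ k * (e.1 * z.2 - e.2 * z.1) := by
      intro k
      induction k with
      | zero => simp
      | succ k ih =>
        rw [Function.iterate_succ_apply', hGF, pow_succ']
        simp only [Prod.fst_add, Prod.snd_add, Prod.smul_fst, Prod.smul_snd, smul_eq_mul]
        linear_combination (1 - μ) * ih + hFe (Gμ^[k] z)
    have hz0 : e.1 * z.2 - e.2 * z.1 = 0 := by
      have h1 := hu n
      rw [hz] at h1
      refine (mul_eq_zero_iff_left (sub_ne_zero.2 hpow)).1 ?_
      linear_combination -h1
    obtain ⟨c, hc⟩ := exists_eq_smul_of_cross_eq_zero he hz0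
    have hFc : ∀ r : ℝ, F (r • e) = 0 := fun r => by
      simpa [hF0] using hconst 0 r
    have hit : ∀ k : ℕ, Gμ^[k] z = (1 - μ) ^ k • z := by
      intro k
      induction k with
      | zero => simp
      | succ k ih =>
        rw [Function.iterate_succ_apply', ih, hGF, hc, smul_smul _ c e, hFc, pow_succ']
        module
    have hzz : z = 0 := by
      rw [hit n] at hz
      have h1 : ((1 - μ) ^ n - 1) • z = 0 := by rw [sub_smul, hz, one_smul, sub_self]
      exact (smul_eq_zero_iff_right (sub_ne_zero.2 hpow)).1 h1
    rw [hzz, hGF, hF0]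
    simp
end
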